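/- Let ω be a C^∞ solution of −Δω = ω in Ω with ∂ω/∂n = 0 and ω = 1 on ∂Ω. Then for any complex constants c₁, c₂, c₃ and ψ = c₁ ω_xx + c₂ ω_xy + c₃ ω_yy, the quadratic form B(ψ, ψ; 1) = ∫∫_Ω (|ψ_x|² + |ψ_y|² − |ψ|²) dx dy satisfies B(ψ, ψ; 1) = −½ ∫₀^{2π} |c₁ cos 2θ + c₂ sin 2θ − c₃ cos 2θ|² dθ ≤ 0, where θ is the tangent angle along ∂Ω used as variable of integration. -/

import Mathlib

noncomputable section
open Real MeasureTheory ComplexConjugate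

/-- Partial derivative in the `x` direction. -/
def pdx (u : ℝ × ℝ → ℝ) (p : ℝ × ℝ) : ℝ := fderiv ℝ u p (1, 0)

/-- Partial derivative in the `y` direction. -/
def pdy (u : ℝ × ℝ → ℝ) (p : ℝ × ℝ) : ℝ := fderiv ℝ u p (0, 1)

/-- The Laplacian on `ℝ²`. -/
def lap (u : ℝ × ℝ → ℝ) (p : ℝ × ℝ) : ℝ := pdx (pdx u) p + pdy (pdy u) p

/-- Partial derivative in the `x` direction, for complex-valued functions. -/
def pdxC (u : ℝ × ℝ → ℂ) (p : ℝ × ℝ) : ℂ := fderiv ℝ u p (1, 0)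

/-- Partial derivative in the `y` direction, for complex-valued functions. -/
def pdyC (u : ℝ × ℝ → ℂ) (p : ℝ × ℝ) : ℂ := fderiv ℝ u p (0, 1)

/-- Normal derivative with respect to the outward unit normal
`n = (sin θ, -cos θ)`, where `θ` is the tangent angle at the boundary point. -/
def nderiv (th : ℝ) (u : ℝ × ℝ → ℝ) (p : ℝ × ℝ) : ℝ :=
  Real.sin th * pdx u p - Real.cos th * pdy u p

/-- Normal derivative for complex-valued functions. -/
def nderivC (th : ℝ) (u : ℝ × ℝ → ℂ) (p : ℝ × ℝ) : ℂ :=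
  (Real.sin th : ℂ) * pdxC u p - (Real.cos th : ℂ) * pdyC u p

/-- The rotation generator `R = -y ∂/∂x + x ∂/∂y`. -/
def Rop (u : ℝ × ℝ → ℝ) (p : ℝ × ℝ) : ℝ := -p.2 * pdx u p + p.1 * pdy u p

/-- The scaling generator `S = x ∂/∂x + y ∂/∂y`. -/
def Sop (u : ℝ × ℝ → ℝ) (p : ℝ × ℝ) : ℝ := p.1 * pdx u p + p.2 * pdy u p

/-- `Ω` is a (Euclidean) disk. -/
def IsDisk (Om : Set (ℝ × ℝ)) : Prop :=
  ∃ z : ℝ × ℝ, ∃ r : ℝ, 0 < r ∧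
    Om = {p : ℝ × ℝ | (p.1 - z.1) ^ 2 + (p.2 - z.2) ^ 2 < r ^ 2}

/-- `u` is `C^∞` on the closure of `Ω` (i.e. on an open neighborhood of it). -/
def SmoothNearClosure (Om : Set (ℝ × ℝ)) (u : ℝ × ℝ → ℝ) : Prop :=
  ∃ U : Set (ℝ × ℝ), IsOpen U ∧ closure Om ⊆ U ∧ ContDiffOn ℝ (⊤ : ℕ∞) u U

/-- Complexified gradient `∇u = u_x + i u_y`. -/
def gradC (u : ℝ × ℝ → ℝ) (p : ℝ × ℝ) : ℂ :=
  (pdx u p : ℂ) + Complex.I * (pdy u p : ℂ)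

/-- Complexified conjugate gradient `∇̄u = u_x - i u_y`. -/
def gradbarC (u : ℝ × ℝ → ℝ) (p : ℝ × ℝ) : ℂ :=
  (pdx u p : ℂ) - Complex.I * (pdy u p : ℂ)

/-- The bilinear form `B(φ, ψ; λ) = ∫∫_Ω (φ_x ψ̄_x + φ_y ψ̄_y - λ φ ψ̄)`. -/
def Bform (Om : Set (ℝ × ℝ)) (lam : ℝ) (phi psi : ℝ × ℝ → ℂ) : ℂ :=
  ∫ p in Om, (pdxC phi p * conj (pdxC psi p) + pdyC phi p * conj (pdyC psi p)
    - (lam : ℂ) * phi p * conj (psi p))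



lemma hopf_stay (ψ : ℝ → ℝ) (hψ : Continuous ψ) (a b : ℝ) (hab : a ≤ b)
    (hs : ∀ x ∈ Set.Icc a b, 0 ≤ Real.sin (ψ x))
    (ha : Real.cos (ψ a) = -1) (hb : Real.cos (ψ b) = 1) : ψ b = ψ a - π := by
  rw [Real.cos_eq_neg_one_iff] at ha
  rw [Real.cos_eq_one_iff] at hb
  obtain ⟨m, hm⟩ := ha
  obtain ⟨n, hn⟩ := hb
  have hpi := Real.pi_pos
  rcases lt_trichotomy n m with h | h | h
  · exfalso
    have h1 : (n : ℝ) + 1 ≤ m := by exact_mod_cast h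
    have : ψ a - 3 * π / 2 ∈ Set.Icc (ψ b) (ψ a) := by
      constructor <;> nlinarith
    obtain ⟨x, hx, hxe⟩ := intermediate_value_Icc' hab hψ.continuousOn this
    have := hs x hx
    rw [hxe, ← hm, show π + m * (2 * π) - 3 * π / 2 = -(π / 2) + m * (2 * π) by ring,
      Real.sin_add_int_mul_two_pi] at this
    simp at this
    linarith
  · subst h; linarith
  · exfalso
    have h1 : (m : ℝ) + 1 ≤ n := by exact_mod_cast h
    have : ψ a + π / 2 ∈ Set.Icc (ψ a) (ψ b) := by
      constructor <;> nlinarith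
    obtain ⟨x, hx, hxe⟩ := intermediate_value_Icc hab hψ.continuousOn this
    have := hs x hx
    rw [hxe, ← hm, show π + m * (2 * π) + π / 2 = (π / 2 + π) + m * (2 * π) by ring,
      Real.sin_add_int_mul_two_pi, Real.sin_add_pi] at this
    simp at this
    linarith

/-- Averaged tangent along an arc. -/
def secq (θ : ℝ → ℝ) (s h : ℝ) : ℂ :=
  ∫ u in (0 : ℝ)..1, Complex.exp (θ (s + u * h) * Complex.I)

lemma secq_cont (θ : ℝ → ℝ) (hθ : Continuous θ) :
    Continuous (fun p : ℝ × ℝ => secq θ p.1 p.2) := by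
  unfold secq
  apply intervalIntegral.continuous_parametric_intervalIntegral_of_continuous' (μ := volume)
    (f := fun (p : ℝ × ℝ) (u : ℝ) => Complex.exp (θ (p.1 + u * p.2) * Complex.I))
  simp only [Function.uncurry_def]
  fun_prop

lemma secq_zero (θ : ℝ → ℝ) (s : ℝ) : secq θ s 0 = Complex.exp (θ s * Complex.I) := by
  simp [secq]

lemma secq_mul (X Y θ : ℝ → ℝ) (hθ : Continuous θ)
    (hX : ∀ s, HasDerivAt X (Real.cos (θ s)) s) (hY : ∀ s, HasDerivAt Y (Real.sin (θ s)) s)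
    (s h : ℝ) : (h : ℂ) * secq θ s h =
      ((X (s + h) - X s : ℝ) : ℂ) + ((Y (s + h) - Y s : ℝ) : ℂ) * Complex.I := by
  have hZ : ∀ u : ℝ, HasDerivAt (fun u : ℝ => ((X (s + u * h) : ℝ) : ℂ) +
      ((Y (s + u * h) : ℝ) : ℂ) * Complex.I)
      ((h : ℂ) * Complex.exp (θ (s + u * h) * Complex.I)) u := by
    intro u
    have h0 : HasDerivAt (fun u : ℝ => s + u * h) h u := by
      simpa using ((hasDerivAt_id u).mul_const h).const_add s
    have h1 := ((hX (s + u * h)).comp u h0).ofReal_comp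
    have h2 := ((hY (s + u * h)).comp u h0).ofReal_comp.mul_const Complex.I
    refine (h1.add h2).congr_deriv ?_
    rw [Complex.exp_mul_I]
    push_cast
    ring
  have := intervalIntegral.integral_eq_sub_of_hasDerivAt (a := 0) (b := 1)
    (fun u _ => hZ u) (Continuous.intervalIntegrable (by fun_prop) _ _)
  rw [intervalIntegral.integral_const_mul] at this
  rw [secq, this]
  simp
  ring

lemma hopf_lowest (X Y θ : ℝ → ℝ) (hθ : Continuous θ) (L : ℝ) (hL : 0 < L)
    (hX : ∀ s, HasDerivAt X (Real.cos (θ s)) s) (hY : ∀ s, HasDerivAt Y (Real.sin (θ s)) s)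
    (hXp : ∀ s, X (s + L) = X s) (hYp : ∀ s, Y (s + L) = Y s)
    (hθper : ∀ s, θ (s + L) = θ s + 2 * π)
    (hinj : ∀ s h, 0 < h → h < L → ¬ (X (s + h) = X s ∧ Y (s + h) = Y s))
    (s₀ : ℝ) (hmin : ∀ s, Y s₀ ≤ Y s) : Real.cos (θ s₀) = 1 ∧ Real.sin (θ s₀) = 0 := by
  have hsin : Real.sin (θ s₀) = 0 := by
    refine IsLocalMin.hasDerivAt_eq_zero (f := Y) (a := s₀) ?_ (hY s₀)
    exact Filter.Eventually.of_forall hmin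
  refine ⟨?_, hsin⟩
  have hsq := Real.sin_sq_add_cos_sq (θ s₀)
  rw [hsin] at hsq
  have hcc : (Real.cos (θ s₀) - 1) * (Real.cos (θ s₀) + 1) = 0 := by nlinarith
  rcases mul_eq_zero.mp hcc with h | hneg
  · linarith
  exfalso
  have hcos : Real.cos (θ s₀) = -1 := by linarith
  set cl : ℝ → ℝ := fun h => max 0 (min h L) with hcl
  have hclc : Continuous cl := by fun_prop
  have hcl_id : ∀ h, 0 ≤ h → h ≤ L → cl h = h := by
    intro h h0 h1
    simp [hcl, h0, h1]
  have hcl0 : ∀ h, 0 ≤ cl h := fun h => le_max_left _ _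
  have hclL : ∀ h, cl h ≤ L := fun h => max_le hL.le (min_le_right _ _)
  set g : ℝ × ℝ → ℂ := fun p => if cl p.2 ≤ L / 2 then secq θ p.1 (cl p.2)
    else - secq θ (p.1 + cl p.2) (L - cl p.2) with hg
  have hq := secq_cont θ hθ
  have hgc : Continuous g := by
    apply Continuous.if_le
    · exact hq.comp (by fun_prop : Continuous fun p : ℝ × ℝ => (p.1, cl p.2))
    · exact (hq.comp (by fun_prop : Continuous fun p : ℝ × ℝ => (p.1 + cl p.2, L - cl p.2))).neg
    · fun_prop
    · fun_prop
    · intro p hp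
      have h1 := secq_mul X Y θ hθ hX hY p.1 (L / 2)
      have h2 := secq_mul X Y θ hθ hX hY (p.1 + L / 2) (L / 2)
      rw [hp]
      have e : p.1 + L / 2 + L / 2 = p.1 + L := by ring
      rw [e, hXp, hYp] at h2
      have hne : ((L / 2 : ℝ) : ℂ) ≠ 0 := by
        exact_mod_cast (by positivity : L / 2 ≠ 0)
      rw [show L - L / 2 = L / 2 by ring]
      apply mul_left_cancel₀ hne
      rw [mul_neg, h1, h2]
      push_cast
      ring
  have hgmul : ∀ s h, 0 ≤ h → h ≤ L → ∃ c : ℝ, 0 ≤ c ∧ (0 < h → h < L → 0 < c) ∧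
      (c : ℂ) * g (s, h) =
        ((X (s + h) - X s : ℝ) : ℂ) + ((Y (s + h) - Y s : ℝ) : ℂ) * Complex.I := by
    intro s h h0 h1
    by_cases hh : h ≤ L / 2
    · refine ⟨h, h0, fun h _ => h, ?_⟩
      simp only [hg, hcl_id h h0 h1, if_pos hh]
      exact secq_mul X Y θ hθ hX hY s h
    · refine ⟨L - h, by linarith, fun _ h => by linarith, ?_⟩
      simp only [hg, hcl_id h h0 h1, if_neg hh]
      have h2 := secq_mul X Y θ hθ hX hY (s + h) (L - h)
      have e : s + h + (L - h) = s + L := by ring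
      rw [e, hXp, hYp] at h2
      rw [mul_neg, h2]
      push_cast
      ring
  have hg0 : ∀ s, g (s, 0) = Complex.exp (θ s * Complex.I) := by
    intro s
    simp only [hg, hcl_id 0 le_rfl hL.le, if_pos (by positivity : (0 : ℝ) ≤ L / 2), secq_zero]
  have hgL : ∀ s, g (s, L) = - Complex.exp (θ s * Complex.I) := by
    intro s
    have : ¬ (L ≤ L / 2) := by linarith
    simp only [hg, hcl_id L hL.le le_rfl, if_neg this, sub_self, secq_zero, hθper]
    push_cast
    rw [add_mul, Complex.exp_add, Complex.exp_two_pi_mul_I, mul_one]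
  have hgne' : ∀ s h, 0 ≤ h → h ≤ L → g (s, h) ≠ 0 := by
    intro s h h0 h1
    rcases h0.eq_or_lt with rfl | h0'
    · rw [hg0]; exact Complex.exp_ne_zero _
    rcases h1.eq_or_lt with rfl | h1'
    · rw [hgL]; exact neg_ne_zero.mpr (Complex.exp_ne_zero _)
    intro hz
    obtain ⟨c, -, -, hc⟩ := hgmul s h h0 h1
    rw [hz, mul_zero] at hc
    have hre := congrArg Complex.re hc
    have him := congrArg Complex.im hc
    simp at hre him
    exact hinj s h h0' h1' ⟨by linarith, by linarith⟩
  have hgne : ∀ p, g p ≠ 0 := by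
    rintro ⟨s, h⟩
    have : g (s, h) = g (s, cl h) := by
      simp only [hg, hcl_id (cl h) (hcl0 h) (hclL h)]
    rw [this]
    exact hgne' _ _ (hcl0 h) (hclL h)
  have hsc : IsSimplyConnected (Set.univ : Set (ℝ × ℝ)) := by
    have := convex_univ (𝕜 := ℝ) (E := ℝ × ℝ) |>.contractibleSpace Set.univ_nonempty
    exact SimplyConnectedSpace.ofContractible _
  obtain ⟨f, hfc, hfe⟩ := Complex.exists_continuousOn_eqOn_exp_comp hsc isOpen_univ
    hgc.continuousOn (by rintro ⟨p, -, hp⟩; exact hgne p hp)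
  have hfc : Continuous f := by simpa [continuousOn_univ] using hfc
  have hfe : ∀ p, Complex.exp (f p) = g p := fun p => hfe (Set.mem_univ p)
  have him : ∀ p, (g p).im = Real.exp (f p).re * Real.sin (f p).im := by
    intro p; rw [← hfe, Complex.exp_im]
  have hre : ∀ p, (g p).re = Real.exp (f p).re * Real.cos (f p).im := by
    intro p; rw [← hfe, Complex.exp_re]
  have hcosf : ∀ p, ∀ e : ℝ, e ^ 2 = 1 → g p = e → Real.cos (f p).im = e := by
    intro p e he hp
    have h1 := him p
    have h2 := hre p
    rw [hp] at h1 h2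
    simp at h1 h2
    have h3 := Real.sin_sq_add_cos_sq (f p).im
    rw [h1] at h3
    have h4 : Real.cos (f p).im ^ 2 = 1 := by linarith
    have h5 := Real.exp_pos (f p).re
    rw [h2, mul_pow, h4] at he
    have h6 : Real.exp (f p).re = 1 := by nlinarith
    rw [h2, h6]; ring
  have hexp : Complex.exp (θ s₀ * Complex.I) = ((-1 : ℝ) : ℂ) := by
    rw [Complex.exp_mul_I, ← Complex.ofReal_cos, ← Complex.ofReal_sin, hcos, hsin]; simp
  have hexpL : Complex.exp (θ (s₀ + L) * Complex.I) = ((-1 : ℝ) : ℂ) := by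
    rw [Complex.exp_mul_I, ← Complex.ofReal_cos, ← Complex.ofReal_sin, hθper, Real.cos_add_two_pi,
      Real.sin_add_two_pi, hcos, hsin]; simp
  have hdiag : (f (s₀ + L, 0)).im - θ (s₀ + L) = (f (s₀, 0)).im - θ s₀ := by
    have hn : ∀ s, ∃ n : ℤ, (f (s, 0)).im - θ s = n * (2 * π) := by
      intro s
      have := (hfe (s, 0)).trans (hg0 s)
      rw [Complex.exp_eq_exp_iff_exists_int] at this
      obtain ⟨n, hn⟩ := this
      refine ⟨n, ?_⟩
      have := congrArg Complex.im hn
      simp at this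
      linarith
    choose n hn using hn
    have hnc : Continuous n := by
      rw [Int.isClosedEmbedding_coe_real.isEmbedding.continuous_iff]
      have : ((fun z : ℤ => (z : ℝ)) ∘ n) = fun s => ((f (s, 0)).im - θ s) / (2 * π) := by
        funext s
        simp only [Function.comp, hn s]
        field_simp
      rw [this]
      fun_prop
    rw [hn, hn, PreconnectedSpace.constant inferInstance hnc (x := s₀ + L) (y := s₀)]
  have hA := hopf_stay (fun h => (f (s₀, h)).im) (by fun_prop) 0 L hL.le (by
      intro h hh
      by_contra hlt
      push Not at hlt
      have h1 := him (s₀, h)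
      have h2 : (g (s₀, h)).im < 0 := by
        rw [h1]; exact mul_neg_of_pos_of_neg (Real.exp_pos _) hlt
      rcases hh.1.eq_or_lt with rfl | h0'
      · rw [hg0, hexp] at h2; simp at h2
      rcases hh.2.eq_or_lt with rfl | h1'
      · rw [hgL, hexp] at h2; simp at h2
      obtain ⟨c, -, hc0, hc⟩ := hgmul s₀ h hh.1 hh.2
      have hc0 := hc0 h0' h1'
      have := congrArg Complex.im hc
      simp at this
      have := hmin (s₀ + h)
      nlinarith)
    (hcosf _ _ (by norm_num) ((hg0 s₀).trans hexp))
    (hcosf _ _ (by norm_num) ((hgL s₀).trans (by rw [hexp]; simp)))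
  have hB := hopf_stay (fun s => (f (s₀ + s, L - s)).im + π) (by fun_prop) 0 L hL.le (by
      intro h hh
      rw [Real.sin_add_pi]
      by_contra hlt
      push Not at hlt
      have hlt : 0 < Real.sin (f (s₀ + h, L - h)).im := by linarith
      have h1 := him (s₀ + h, L - h)
      have h2 : 0 < (g (s₀ + h, L - h)).im := by
        rw [h1]; exact mul_pos (Real.exp_pos _) hlt
      rcases hh.1.eq_or_lt with rfl | h0'
      · rw [add_zero, sub_zero, hgL, hexp] at h2; simp at h2
      rcases hh.2.eq_or_lt with rfl | h1'
      · rw [sub_self, hg0, hexpL] at h2; simp at h2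
      obtain ⟨c, -, hc0, hc⟩ := hgmul (s₀ + h) (L - h) (by linarith) (by linarith)
      have hc0 := hc0 (by linarith) (by linarith)
      have := congrArg Complex.im hc
      rw [show s₀ + h + (L - h) = s₀ + L by ring, hXp, hYp] at this
      simp at this
      have := hmin (s₀ + h)
      nlinarith)
    (by
      simp only [add_zero, sub_zero, Real.cos_add_pi]
      rw [hcosf (s₀, L) 1 (by norm_num) ((hgL s₀).trans (by rw [hexp]; simp))])
    (by
      simp only [sub_self, Real.cos_add_pi]
      rw [hcosf (s₀ + L, 0) (-1) (by norm_num) ((hg0 _).trans hexpL)]; simp)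
  simp only [add_zero, sub_zero, sub_self] at hA hB
  rw [hθper] at hdiag
  have := Real.pi_pos
  linarith
open Real MeasureTheory ComplexConjugate

/-- A simple closed arclength-parametrized curve `(X, Y)` with tangent angle `θ`, curvature `k`. -/
structure Crv (X Y θ k : ℝ → ℝ) (L : ℝ) : Prop where
  hL : 0 < L
  hX : ∀ s, HasDerivAt X (Real.cos (θ s)) s
  hY : ∀ s, HasDerivAt Y (Real.sin (θ s)) s
  hθ : ∀ s, HasDerivAt θ (k s) s
  cX : ContDiff ℝ 1 X
  cY : ContDiff ℝ 1 Y
  cθ : ContDiff ℝ 1 θ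
  ck : ContDiff ℝ 1 k
  pX : ∀ s, X (s + L) = X s
  pY : ∀ s, Y (s + L) = Y s
  pθ : ∀ s, θ (s + L) = θ s + 2 * π
  inj : ∀ s h, 0 < h → h < L → ¬ (X (s + h) = X s ∧ Y (s + h) = Y s)

/-- Tubular coordinates. -/
def Tub (X Y θ : ℝ → ℝ) (p : ℝ × ℝ) : ℝ × ℝ :=
  (X p.1 - p.2 * Real.sin (θ p.1), Y p.1 + p.2 * Real.cos (θ p.1))

lemma tub_near (X Y θ k : ℝ → ℝ) (L : ℝ) (H : Crv X Y θ k L) (κ : ℝ) (hκ : 0 < κ)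
    (hlip : ∀ u v, |θ u - θ v| ≤ κ * |u - v|) (s s' r r' : ℝ) (hs : s ≤ s') (hs' : s' - s ≤ 1 / κ)
    (hr' : |r'| * κ < 1 / 2) (he : Tub X Y θ (s, r) = Tub X Y θ (s', r')) : s' = s := by
  by_contra hne
  have hlt : s < s' := lt_of_le_of_ne hs (Ne.symm hne)
  have hp : ∀ u, HasDerivAt (fun u => X u * Real.cos (θ s) + Y u * Real.sin (θ s))
      (Real.cos (θ u - θ s)) u := by
    intro u
    refine (((H.hX u).mul_const _).add ((H.hY u).mul_const _)).congr_deriv ?_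
    rw [Real.cos_sub]
  obtain ⟨c, hc, hce⟩ := exists_hasDerivAt_eq_slope _ _ hlt
    (fun x _ => (hp x).continuousAt.continuousWithinAt) (fun x _ => hp x)
  have h1 : |θ c - θ s| ≤ 1 := by
    refine (hlip c s).trans ?_
    rw [abs_of_pos (by linarith [hc.1])]
    have : c - s ≤ 1 / κ := by linarith [hc.2]
    calc κ * (c - s) ≤ κ * (1 / κ) := by gcongr
      _ = 1 := by field_simp
  have h2 : 1 / 2 ≤ Real.cos (θ c - θ s) := by
    have := Real.one_sub_sq_div_two_le_cos (x := θ c - θ s)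
    have h3 : (θ c - θ s) ^ 2 ≤ 1 := by
      rw [← sq_abs]; nlinarith [abs_nonneg (θ c - θ s)]
    linarith
  have hpos : 0 < s' - s := by linarith
  rw [hce, le_div_iff₀ hpos] at h2
  simp only [Tub, Prod.mk.injEq] at he
  obtain ⟨e1, e2⟩ := he
  have h4 : X s' * Real.cos (θ s) + Y s' * Real.sin (θ s) -
      (X s * Real.cos (θ s) + Y s * Real.sin (θ s)) = r' * Real.sin (θ s' - θ s) := by
    rw [Real.sin_sub]
    linear_combination (-Real.cos (θ s)) * e1 - Real.sin (θ s) * e2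
  rw [h4] at h2
  have h5 : |Real.sin (θ s' - θ s)| ≤ κ * (s' - s) := by
    refine (Real.abs_sin_le_abs).trans ((hlip s' s).trans ?_)
    rw [abs_of_pos hpos]
  have h6 : r' * Real.sin (θ s' - θ s) ≤ |r'| * (κ * (s' - s)) := by
    refine (le_abs_self _).trans ?_
    rw [abs_mul]
    gcongr
  nlinarith

lemma tub_per (X Y θ k : ℝ → ℝ) (L : ℝ) (H : Crv X Y θ k L) (r : ℝ) :
    Function.Periodic (fun s => Tub X Y θ (s, r)) L := by
  intro s
  simp [Tub, H.pX, H.pY, H.pθ]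

lemma crv_lip (X Y θ k : ℝ → ℝ) (L : ℝ) (H : Crv X Y θ k L) :
    ∃ κ, 0 < κ ∧ (∀ s, |k s| ≤ κ) ∧ ∀ u v, |θ u - θ v| ≤ κ * |u - v| := by
  have hkp : Function.Periodic k L := by
    intro s
    have h1 := (H.hθ (s + L)).comp_add_const s L
    have h2 : (fun x => θ (x + L)) = fun x => θ x + 2 * π := funext H.pθ
    rw [h2] at h1
    exact h1.unique ((H.hθ s).add_const _)
  obtain ⟨C, hC⟩ := (isCompact_Icc (a := (0 : ℝ)) (b := L)).exists_bound_of_continuousOn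
    H.ck.continuous.continuousOn
  have hb : ∀ s, |k s| ≤ |C| + 1 := by
    intro s
    obtain ⟨y, hy, hye⟩ := hkp.exists_mem_Ico₀ H.hL s
    rw [hye]
    have := hC y ⟨hy.1, hy.2.le⟩
    rw [Real.norm_eq_abs] at this
    linarith [le_abs_self C]
  refine ⟨|C| + 1, by positivity, hb, ?_⟩
  intro u v
  have := Convex.norm_image_sub_le_of_norm_hasDerivWithin_le (f := θ) (f' := k) (s := Set.univ)
    (x := v) (y := u) (C := |C| + 1)
    (fun x _ => (H.hθ x).hasDerivWithinAt) (fun x _ => hb x) convex_univ trivial trivial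
  simpa using this

lemma tub_inj (X Y θ k : ℝ → ℝ) (L : ℝ) (H : Crv X Y θ k L) :
    ∃ δ, 0 < δ ∧ (∀ s r, |r| ≤ δ → 0 < 1 - r * k s) ∧
      ∀ s s' r r', |r| ≤ δ → |r'| ≤ δ → Tub X Y θ (s, r) = Tub X Y θ (s', r') →
        r = r' ∧ ∃ n : ℤ, s' = s + n * L := by
  obtain ⟨κ, hκ, hk, hlip⟩ := crv_lip X Y θ k L H
  have hL := H.hL
  set η := 1 / κ with hη
  have hηpos : 0 < η := by positivity
  have hsep : ∃ m, 0 < m ∧ ∀ s h, 0 ≤ s → s ≤ L → η ≤ h → h ≤ L - η →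
      m ≤ (X (s + h) - X s) ^ 2 + (Y (s + h) - Y s) ^ 2 := by
    set D : ℝ × ℝ → ℝ := fun p => (X (p.1 + p.2) - X p.1) ^ 2 + (Y (p.1 + p.2) - Y p.1) ^ 2
    have hDc : Continuous D := by
      have := H.cX.continuous
      have := H.cY.continuous
      fun_prop
    have hK : IsCompact (Set.Icc (0 : ℝ) L ×ˢ Set.Icc η (L - η)) := isCompact_Icc.prod isCompact_Icc
    rcases (Set.Icc (0 : ℝ) L ×ˢ Set.Icc η (L - η)).eq_empty_or_nonempty with he | hne
    · refine ⟨1, one_pos, fun s h h1 h2 h3 h4 => ?_⟩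
      have : (s, h) ∈ (Set.Icc (0 : ℝ) L ×ˢ Set.Icc η (L - η)) := ⟨⟨h1, h2⟩, h3, h4⟩
      rw [he] at this
      exact this.elim
    · obtain ⟨p, hp, hmin⟩ := hK.exists_isMinOn hne hDc.continuousOn
      refine ⟨D p, ?_, fun s h h1 h2 h3 h4 => hmin (a := (s, h)) ⟨⟨h1, h2⟩, h3, h4⟩⟩
      have hn := H.inj p.1 p.2 (by linarith [hp.2.1]) (by linarith [hp.2.2])
      by_contra hle
      push Not at hle
      apply hn
      have a1 := sq_nonneg (X (p.1 + p.2) - X p.1)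
      have a2 := sq_nonneg (Y (p.1 + p.2) - Y p.1)
      have b1 : (X (p.1 + p.2) - X p.1) ^ 2 = 0 := by simp only [D] at hle; linarith
      have b2 : (Y (p.1 + p.2) - Y p.1) ^ 2 = 0 := by simp only [D] at hle; linarith
      constructor
      · nlinarith [pow_eq_zero_iff (two_ne_zero) |>.mp b1]
      · nlinarith [pow_eq_zero_iff (two_ne_zero) |>.mp b2]
  obtain ⟨m, hm, hsep⟩ := hsep
  set δ := min (1 / (4 * κ)) (min 1 (m / 16)) with hδ
  have hδpos : 0 < δ := by positivity
  have hδκ : δ * κ < 1 / 2 := by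
    have : δ ≤ 1 / (4 * κ) := min_le_left _ _
    calc δ * κ ≤ 1 / (4 * κ) * κ := by gcongr
      _ = 1 / 4 := by field_simp
      _ < 1 / 2 := by norm_num
  have hδ1 : δ ≤ 1 := (min_le_right _ _).trans (min_le_left _ _)
  have hδm : δ ≤ m / 16 := (min_le_right _ _).trans (min_le_right _ _)
  have hrk : ∀ r, |r| ≤ δ → |r| * κ < 1 / 2 := fun r hr =>
    lt_of_le_of_lt (by gcongr) hδκ
  refine ⟨δ, hδpos, ?_, ?_⟩
  · intro s r hr
    have h1 : r * k s ≤ |r| * κ := by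
      refine (le_abs_self _).trans ?_
      rw [abs_mul]
      gcongr
      exact hk s
    linarith [hrk r hr]
  · have main : ∀ s s' r r', |r| ≤ δ → |r'| ≤ δ → Tub X Y θ (s, r) = Tub X Y θ (s', r') →
        ∃ n : ℤ, s' = s + n * L := by
      intro s s' r r' hr hr' he
      obtain ⟨n, hn⟩ : ∃ n : ℤ, (s' - s) - n * L ∈ Set.Ico 0 L := by
        refine ⟨toIcoDiv hL 0 (s' - s), ?_⟩
        have := toIcoMod_mem_Ico' hL (s' - s)
        rw [toIcoMod] at this
        simpa using this
      set h := (s' - s) - n * L with hh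
      have hT : Tub X Y θ (s + h, r') = Tub X Y θ (s', r') := by
        have := ((tub_per X Y θ k L H r').int_mul n) (s + h)
        rw [show s + h + n * L = s' by rw [hh]; ring] at this
        exact this.symm
      rcases le_or_gt h η with h1 | h1
      · have := tub_near X Y θ k L H κ hκ hlip s (s + h) r r' (by linarith [hn.1]) (by linarith)
          (hrk r' hr') (he.trans hT.symm)
        exact ⟨n, by rw [hh] at this; linarith⟩
      rcases le_or_gt (L - η) h with h2 | h2
      · have hT2 : Tub X Y θ (s + L, r) = Tub X Y θ (s, r) := tub_per X Y θ k L H r s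
        have := tub_near X Y θ k L H κ hκ hlip (s + h) (s + L) r' r (by linarith [hn.2])
          (by linarith) (hrk r hr) (hT.trans (he.symm.trans hT2.symm))
        refine ⟨n + 1, ?_⟩
        push_cast
        rw [hh] at this; linarith
      exfalso
      obtain ⟨s₁, hs₁, hse⟩ : ∃ s₁ ∈ Set.Ico 0 L, ∃ j : ℤ, s = s₁ + j * L := by
        refine ⟨toIcoMod hL 0 s, toIcoMod_mem_Ico' hL s, toIcoDiv hL 0 s, ?_⟩
        simp
      obtain ⟨j, hj⟩ := hse
      have hXp : Function.Periodic X L := H.pX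
      have hYp : Function.Periodic Y L := H.pY
      have := hsep s₁ h hs₁.1 hs₁.2.le h1.le h2.le
      have e1 := hXp.int_mul j (s₁ + h)
      have e2 := hXp.int_mul j s₁
      have e3 := hYp.int_mul j (s₁ + h)
      have e4 := hYp.int_mul j s₁
      rw [show s₁ + h + j * L = s + h by rw [hj]; ring] at e1 e3
      rw [← hj] at e2 e4
      rw [← e1, ← e2, ← e3, ← e4] at this
      have he2 := he.trans hT.symm
      simp only [Tub, Prod.mk.injEq] at he2
      obtain ⟨f1, f2⟩ := he2
      have hbound : ∀ a b, |a| ≤ δ → |b| ≤ 1 → |a * b| ≤ δ := by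
        intro a b ha hb
        rw [abs_mul]
        calc |a| * |b| ≤ δ * 1 := by gcongr
          _ = δ := mul_one _
      have g1 := abs_le.mp (hbound r _ hr (Real.abs_sin_le_one (θ s)))
      have g2 := abs_le.mp (hbound r _ hr (Real.abs_cos_le_one (θ s)))
      have g3 := abs_le.mp (hbound r' _ hr' (Real.abs_sin_le_one (θ (s + h))))
      have g4 := abs_le.mp (hbound r' _ hr' (Real.abs_cos_le_one (θ (s + h))))
      have i1 : (X (s + h) - X s) ^ 2 ≤ (2 * δ) ^ 2 := by
        apply sq_le_sq' <;> linarith [g1.1, g1.2, g3.1, g3.2]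
      have i2 : (Y (s + h) - Y s) ^ 2 ≤ (2 * δ) ^ 2 := by
        apply sq_le_sq' <;> linarith [g2.1, g2.2, g4.1, g4.2]
      nlinarith
    intro s s' r r' hr hr' he
    obtain ⟨n, hn⟩ := main s s' r r' hr hr' he
    refine ⟨?_, n, hn⟩
    have hT : Tub X Y θ (s, r') = Tub X Y θ (s', r') := by
      have := ((tub_per X Y θ k L H r').int_mul n) s
      rw [← hn] at this
      exact this.symm
    have he2 := he.trans hT.symm
    simp only [Tub, Prod.mk.injEq] at he2
    obtain ⟨f1, f2⟩ := he2
    have := Real.sin_sq_add_cos_sq (θ s)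
    linear_combination (-Real.sin (θ s)) * f1 + Real.cos (θ s) * f2 + (r' - r) * this

/-- Derivative of tubular coordinates. -/
def TubD (θ k : ℝ → ℝ) (p : ℝ × ℝ) : ℝ × ℝ →L[ℝ] ℝ × ℝ :=
  (Matrix.toLin (.finTwoProd ℝ) (.finTwoProd ℝ)
    !![(1 - p.2 * k p.1) * Real.cos (θ p.1), -Real.sin (θ p.1);
      (1 - p.2 * k p.1) * Real.sin (θ p.1), Real.cos (θ p.1)]).toContinuousLinearMap

lemma tub_hasFDerivAt (X Y θ k : ℝ → ℝ) (L : ℝ) (H : Crv X Y θ k L) (p : ℝ × ℝ) :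
    HasFDerivAt (Tub X Y θ) (TubD θ k p) p := by
  unfold TubD
  rw [Matrix.toLin_finTwoProd_toContinuousLinearMap]
  have h1 := (H.hX p.1).comp_hasFDerivAt p (hasFDerivAt_fst (𝕜 := ℝ) (p := p))
  have h2 := (H.hY p.1).comp_hasFDerivAt p (hasFDerivAt_fst (𝕜 := ℝ) (p := p))
  have h3 := ((H.hθ p.1).sin).comp_hasFDerivAt p (hasFDerivAt_fst (𝕜 := ℝ) (p := p))
  have h4 := ((H.hθ p.1).cos).comp_hasFDerivAt p (hasFDerivAt_fst (𝕜 := ℝ) (p := p))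
  have h5 := (h1.sub ((hasFDerivAt_snd (𝕜 := ℝ) (p := p)).mul h3)).prodMk (h2.add ((hasFDerivAt_snd (𝕜 := ℝ) (p := p)).mul h4))
  refine h5.congr_fderiv ?_
  ext <;> simp <;> ring

lemma tub_det (θ k : ℝ → ℝ) (p : ℝ × ℝ) : (TubD θ k p).det = 1 - p.2 * k p.1 := by
  unfold TubD
  simp only [LinearMap.det_toContinuousLinearMap, LinearMap.det_toLin, Matrix.det_fin_two_of]
  linear_combination (1 - p.2 * k p.1) * Real.sin_sq_add_cos_sq (θ p.1)

lemma tub_contDiff (X Y θ k : ℝ → ℝ) (L : ℝ) (H : Crv X Y θ k L) :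
    ContDiff ℝ 1 (Tub X Y θ) := by
  have := H.cX
  have := H.cY
  have := H.cθ
  unfold Tub
  fun_prop

lemma tub_open (X Y θ k : ℝ → ℝ) (L : ℝ) (H : Crv X Y θ k L) (δ : ℝ)
    (hδ : ∀ s r, |r| ≤ δ → 0 < 1 - r * k s) (W : Set (ℝ × ℝ)) (hW : IsOpen W)
    (hWδ : ∀ p ∈ W, |p.2| ≤ δ) : IsOpen (Tub X Y θ '' W) := by
  rw [isOpen_iff_mem_nhds]
  rintro _ ⟨p, hp, rfl⟩
  have hst : HasStrictFDerivAt (Tub X Y θ) (TubD θ k p) p :=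
    (tub_contDiff X Y θ k L H).contDiffAt.hasStrictFDerivAt' (tub_hasFDerivAt X Y θ k L H p)
      (by norm_num)
  have hdet : (TubD θ k p).det ≠ 0 := by
    rw [tub_det]; exact (hδ _ _ (hWδ p hp)).ne'
  have hst' : HasStrictFDerivAt (Tub X Y θ)
      (((TubD θ k p).toContinuousLinearEquivOfDetNeZero hdet : (ℝ × ℝ) ≃L[ℝ] (ℝ × ℝ)) :
        ℝ × ℝ →L[ℝ] ℝ × ℝ) p := hst
  rw [← hst'.map_nhds_eq_of_equiv]
  exact Filter.image_mem_map (hW.mem_nhds hp)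

lemma preconn_subset_of_frontier {C Om : Set (ℝ × ℝ)} (hC : IsPreconnected C) (hO : IsOpen Om)
    (hd : ∀ p ∈ C, p ∉ frontier Om) (hne : (C ∩ Om).Nonempty) : C ⊆ Om := by
  refine hC.subset_left_of_subset_union hO isClosed_closure.isOpen_compl
    (v := (closure Om)ᶜ) ?_ ?_ hne
  · exact Set.disjoint_compl_right_iff_subset.mpr subset_closure
  · intro p hp
    by_cases h : p ∈ Om
    · exact Or.inl h
    · refine Or.inr fun hc => hd p hp ?_
      rw [hO.frontier_eq]
      exact ⟨hc, h⟩

lemma tub_zero (X Y θ : ℝ → ℝ) (s : ℝ) : Tub X Y θ (s, 0) = (X s, Y s) := by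
  simp [Tub]

lemma tub_sides (X Y θ k : ℝ → ℝ) (L : ℝ) (H : Crv X Y θ k L) (Om : Set (ℝ × ℝ)) (hO : IsOpen Om)
    (hb : Bornology.IsBounded Om) (hne : Om.Nonempty)
    (hfr : Set.range (fun s => (X s, Y s)) = frontier Om) (δ : ℝ) (hδ0 : 0 < δ)
    (hδ : ∀ s r, |r| ≤ δ → 0 < 1 - r * k s)
    (hδi : ∀ s s' r r', |r| ≤ δ → |r'| ≤ δ → Tub X Y θ (s, r) = Tub X Y θ (s', r') →
        r = r' ∧ ∃ n : ℤ, s' = s + n * L) :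
    (∀ s r, 0 < r → r < δ → Tub X Y θ (s, r) ∈ Om) ∧
    (∀ s r, -δ < r → r < 0 → Tub X Y θ (s, r) ∉ Om) := by
  have hTc : Continuous (Tub X Y θ) := (tub_contDiff X Y θ k L H).continuous
  have hnf : ∀ s r, |r| ≤ δ → r ≠ 0 → Tub X Y θ (s, r) ∉ frontier Om := by
    intro s r hr h0 hf
    rw [← hfr] at hf
    obtain ⟨s', hs'⟩ := hf
    simp only at hs'
    rw [← tub_zero X Y θ] at hs'
    exact h0 (hδi s' s 0 r (by simpa using hδ0.le) hr hs').1.symm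
  have hP : IsPreconnected (Tub X Y θ '' (Set.univ ×ˢ Set.Ioo 0 δ)) :=
    (isPreconnected_univ.prod isPreconnected_Ioo).image _ hTc.continuousOn
  have hN : IsPreconnected (Tub X Y θ '' (Set.univ ×ˢ Set.Ioo (-δ) 0)) :=
    (isPreconnected_univ.prod isPreconnected_Ioo).image _ hTc.continuousOn
  have hKc : IsCompact (closure Om) := hb.isCompact_closure
  obtain ⟨p, hp, hpm⟩ := hKc.exists_isMinOn hne.closure (continuous_snd.continuousOn)
  have hpm : ∀ q ∈ closure Om, p.2 ≤ q.2 := fun q hq => hpm hq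
  have hpO : p ∉ Om := by
    intro hpO
    have hc : Continuous (fun t : ℝ => (p.1, p.2 - t)) := by fun_prop
    have h0 : (fun t : ℝ => (p.1, p.2 - t)) ⁻¹' Om ∈ nhds (0 : ℝ) :=
      hc.continuousAt.preimage_mem_nhds (hO.mem_nhds (by simpa using hpO))
    rw [Metric.mem_nhds_iff] at h0
    obtain ⟨ε, hε, hball⟩ := h0
    have : ε / 2 ∈ Metric.ball (0 : ℝ) ε := by
      rw [Metric.mem_ball, dist_zero_right, Real.norm_eq_abs, abs_of_pos (by positivity)]
      linarith
    have := hpm _ (subset_closure (hball this))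
    simp only at this
    linarith
  have hpf : p ∈ frontier Om := by rw [hO.frontier_eq]; exact ⟨hp, hpO⟩
  rw [← hfr] at hpf
  obtain ⟨s₀, rfl⟩ := hpf
  have hcl : ∀ s, (X s, Y s) ∈ closure Om := by
    intro s
    apply frontier_subset_closure
    rw [← hfr]
    exact ⟨s, rfl⟩
  obtain ⟨hcos, hsin⟩ := hopf_lowest X Y θ H.cθ.continuous L H.hL H.hX H.hY H.pX H.pY H.pθ H.inj s₀
    (fun s => hpm _ (hcl s))
  have hNout : ∀ s r, -δ < r → r < 0 → Tub X Y θ (s, r) ∉ Om := by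
    intro s r h1 h2 hin
    have hsub := preconn_subset_of_frontier hN hO (by
      rintro _ ⟨⟨a, b⟩, ⟨-, hb1, hb2⟩, rfl⟩
      exact hnf a b (abs_le.mpr ⟨by simp only at hb1; linarith, by simp only at hb2; linarith⟩) hb2.ne)
      ⟨_, ⟨(s, r), ⟨trivial, h1, h2⟩, rfl⟩, hin⟩
    have h3 : Tub X Y θ (s₀, -δ / 2) ∈ Om :=
      hsub ⟨(s₀, -δ / 2), ⟨trivial, by simp only; linarith, by simp only; linarith⟩, rfl⟩
    have := hpm _ (subset_closure h3)
    simp only [Tub, hcos] at this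
    linarith
  refine ⟨?_, hNout⟩
  have hV : IsOpen (Tub X Y θ '' (Set.univ ×ˢ Set.Ioo (-δ) δ)) :=
    tub_open X Y θ k L H δ hδ _ (isOpen_univ.prod isOpen_Ioo) (by
      rintro p ⟨-, h1, h2⟩; exact abs_le.mpr ⟨h1.le, h2.le⟩)
  have h0V : (X 0, Y 0) ∈ Tub X Y θ '' (Set.univ ×ˢ Set.Ioo (-δ) δ) :=
    ⟨(0, 0), ⟨trivial, by simp [hδ0]⟩, tub_zero _ _ _ _⟩
  obtain ⟨q, ⟨⟨s, r⟩, ⟨-, hr1, hr2⟩, hqe⟩, hqO⟩ :=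
    mem_closure_iff.mp (hcl 0) _ hV h0V
  simp only at hr1 hr2
  have hr : 0 < r := by
    rcases lt_trichotomy r 0 with h | h | h
    · rw [← hqe] at hqO
      exact (hNout s r hr1 h hqO).elim
    · exfalso
      subst h
      rw [tub_zero] at hqe
      have : q ∈ frontier Om := by rw [← hfr]; exact ⟨s, hqe⟩
      rw [hO.frontier_eq] at this
      exact this.2 hqO
    · exact h
  have hsub := preconn_subset_of_frontier hP hO (by
      rintro _ ⟨⟨a, b⟩, ⟨-, hb1, hb2⟩, rfl⟩
      exact hnf a b (abs_le.mpr ⟨by simp only at hb1; linarith, by simp only at hb2; linarith⟩) hb1.ne')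
      ⟨q, ⟨(s, r), ⟨trivial, hr, hr2⟩, hqe⟩, hqO⟩
  intro s r h1 h2
  exact hsub ⟨(s, r), ⟨trivial, h1, h2⟩, rfl⟩

/-- Divergence of a pair of complex functions. -/
def dvg (F1 F2 : ℝ × ℝ → ℂ) (p : ℝ × ℝ) : ℂ :=
  fderiv ℝ F1 p (1, 0) + fderiv ℝ F2 p (0, 1)

lemma dvg_cont (F1 F2 : ℝ × ℝ → ℂ) (h1 : ContDiff ℝ 1 F1) (h2 : ContDiff ℝ 1 F2) :
    Continuous (dvg F1 F2) := by
  have a := h1.continuous_fderiv (by norm_num)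
  have b := h2.continuous_fderiv (by norm_num)
  unfold dvg
  fun_prop

lemma dvg_zero (F1 F2 : ℝ × ℝ → ℂ) (p : ℝ × ℝ) (h1 : F1 =ᶠ[nhds p] 0) (h2 : F2 =ᶠ[nhds p] 0) :
    dvg F1 F2 p = 0 := by
  unfold dvg
  rw [h1.fderiv_eq, h2.fderiv_eq]
  simp

lemma dvg_compact (Om : Set (ℝ × ℝ)) (hb : Bornology.IsBounded Om)
    (H1 H2 : ℝ × ℝ → ℂ) (h1 : ContDiff ℝ 1 H1) (h2 : ContDiff ℝ 1 H2)
    (z1 : ∀ p ∉ Om, H1 =ᶠ[nhds p] 0) (z2 : ∀ p ∉ Om, H2 =ᶠ[nhds p] 0) :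
    ∫ p in Om, dvg H1 H2 p = 0 := by
  obtain ⟨R, hR⟩ := hb.exists_norm_le
  have hsub : Om ⊆ Set.Icc ((-(|R| + 1), -(|R| + 1)) : ℝ × ℝ) (|R| + 1, |R| + 1) := by
    intro p hp
    have := hR p hp
    rw [Prod.norm_def, max_le_iff, Real.norm_eq_abs, Real.norm_eq_abs, abs_le, abs_le] at this
    obtain ⟨⟨a, b⟩, c, d⟩ := this
    have := le_abs_self R
    refine ⟨⟨?_, ?_⟩, ?_, ?_⟩ <;> simp only <;> linarith
  have hout : ∀ p : ℝ × ℝ, (|p.1| = |R| + 1 ∨ |p.2| = |R| + 1) → p ∉ Om := by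
    intro p h hp
    have := hR p hp
    rw [Prod.norm_def, max_le_iff, Real.norm_eq_abs, Real.norm_eq_abs] at this
    have := le_abs_self R
    rcases h with h | h <;> linarith [this]
  have hRpos : 0 < |R| + 1 := by positivity
  rw [← setIntegral_eq_of_subset_of_forall_sdiff_eq_zero measurableSet_Icc hsub
    (fun p hp => dvg_zero H1 H2 p (z1 p hp.2) (z2 p hp.2))]
  unfold dvg
  rw [integral_divergence_prod_Icc_of_hasFDerivAt_of_le H1 H2 (fderiv ℝ H1) (fderiv ℝ H2) _ _
    (by constructor <;> simp only <;> linarith)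
    h1.continuous.continuousOn h2.continuous.continuousOn
    (fun x _ => (h1.differentiable (by norm_num) x).hasFDerivAt)
    (fun x _ => (h2.differentiable (by norm_num) x).hasFDerivAt)
    ((dvg_cont H1 H2 h1 h2).continuousOn.integrableOn_compact isCompact_Icc)]
  have e1 : ∀ p : ℝ × ℝ, (|p.1| = |R| + 1 ∨ |p.2| = |R| + 1) → H1 p = 0 :=
    fun p hp => (z1 p (hout p hp)).self_of_nhds
  have e2 : ∀ p : ℝ × ℝ, (|p.1| = |R| + 1 ∨ |p.2| = |R| + 1) → H2 p = 0 :=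
    fun p hp => (z2 p (hout p hp)).self_of_nhds
  have f1 : ∀ y, H1 (|R| + 1, y) = 0 := fun y => e1 _ (Or.inl (abs_of_pos hRpos))
  have f2 : ∀ y, H1 (-(|R| + 1), y) = 0 := fun y =>
    e1 _ (Or.inl (by simp only [abs_neg]; exact abs_of_pos hRpos))
  have f3 : ∀ x, H2 (x, |R| + 1) = 0 := fun x => e2 _ (Or.inr (abs_of_pos hRpos))
  have f4 : ∀ x, H2 (x, -(|R| + 1)) = 0 := fun y =>
    e2 _ (Or.inr (by simp only [abs_neg]; exact abs_of_pos hRpos))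
  simp only [f1, f2, f3, f4]
  simp

lemma clm_pair (D : ℝ × ℝ →L[ℝ] ℂ) (a b : ℝ) : D (a, b) = a • D (1, 0) + b • D (0, 1) := by
  rw [← map_smul, ← map_smul, ← map_add]
  simp

lemma piola (X Y θ k : ℝ → ℝ) (L : ℝ) (H : Crv X Y θ k L) (G1 G2 : ℝ × ℝ → ℂ)
    (h1 : ContDiff ℝ 1 G1) (h2 : ContDiff ℝ 1 G2) (p : ℝ × ℝ) :
    fderiv ℝ (fun p : ℝ × ℝ => Real.cos (θ p.1) • G1 (Tub X Y θ p)
      + Real.sin (θ p.1) • G2 (Tub X Y θ p)) p (1, 0) +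
    fderiv ℝ (fun p : ℝ × ℝ => (1 - p.2 * k p.1) • (Real.cos (θ p.1) • G2 (Tub X Y θ p)
      - Real.sin (θ p.1) • G1 (Tub X Y θ p))) p (0, 1) =
    (1 - p.2 * k p.1) • dvg G1 G2 (Tub X Y θ p) := by
  have d1 := ((h1.differentiable (by norm_num) (Tub X Y θ p)).hasFDerivAt).comp p
    (tub_hasFDerivAt X Y θ k L H p)
  have d2 := ((h2.differentiable (by norm_num) (Tub X Y θ p)).hasFDerivAt).comp p
    (tub_hasFDerivAt X Y θ k L H p)
  have h3 := ((H.hθ p.1).sin).comp_hasFDerivAt p (hasFDerivAt_fst (𝕜 := ℝ) (p := p))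
  have h4 := ((H.hθ p.1).cos).comp_hasFDerivAt p (hasFDerivAt_fst (𝕜 := ℝ) (p := p))
  have hk : HasDerivAt k (deriv k p.1) p.1 :=
    (H.ck.differentiable (by norm_num) p.1).hasDerivAt
  have h5 := hk.comp_hasFDerivAt p (hasFDerivAt_fst (𝕜 := ℝ) (p := p))
  have h6 := ((hasFDerivAt_snd (𝕜 := ℝ) (p := p)).mul h5).const_sub 1
  have hP := (h4.smul d1).add (h3.smul d2)
  have hQ := h6.smul ((h4.smul d2).sub (h3.smul d1))
  have hP' := hP.fderiv
  have hQ' := hQ.fderiv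
  have eP := congrArg (fun D : ℝ × ℝ →L[ℝ] ℂ => D (1, 0)) hP'
  have eQ := congrArg (fun D : ℝ × ℝ →L[ℝ] ℂ => D (0, 1)) hQ'
  have t1 : TubD θ k p (1, 0) = ((1 - p.2 * k p.1) * Real.cos (θ p.1),
      (1 - p.2 * k p.1) * Real.sin (θ p.1)) := by
    simp [TubD, Matrix.toLin_finTwoProd_toContinuousLinearMap]
  have t2 : TubD θ k p (0, 1) = (-Real.sin (θ p.1), Real.cos (θ p.1)) := by
    simp [TubD, Matrix.toLin_finTwoProd_toContinuousLinearMap]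
  refine (congrArg₂ (· + ·) eP eQ).trans ?_
  simp only [dvg, add_apply, sub_apply,
    smul_apply, ContinuousLinearMap.smulRight_apply,
    ContinuousLinearMap.comp_apply, t1, t2, ContinuousLinearMap.coe_fst',
    ContinuousLinearMap.coe_snd', neg_apply, Function.comp_apply, Pi.mul_apply,
    Pi.sub_apply, Pi.smul_apply']
  rw [clm_pair (fderiv ℝ G1 _) (_ * _), clm_pair (fderiv ℝ G2 _) (_ * _),
    clm_pair (fderiv ℝ G1 _) (-_), clm_pair (fderiv ℝ G2 _) (-_)]
  simp only [Complex.real_smul, smul_eq_mul]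
  push_cast
  have hsc : (Complex.sin (θ p.1)) ^ 2 + Complex.cos (θ p.1) ^ 2 = 1 := Complex.sin_sq_add_cos_sq _
  linear_combination ((1 - p.2 * k p.1 : ℂ) * (fderiv ℝ G1 (Tub X Y θ p) (1, 0)
    + fderiv ℝ G2 (Tub X Y θ p) (0, 1))) * hsc


lemma dvg_tube (X Y θ k : ℝ → ℝ) (L : ℝ) (H : Crv X Y θ k L) (Om : Set (ℝ × ℝ)) (hO : IsOpen Om)
    (δ : ℝ) (hδ0 : 0 < δ)
    (hδ : ∀ s r, |r| ≤ δ → 0 < 1 - r * k s)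
    (hδi : ∀ s s' r r', |r| ≤ δ → |r'| ≤ δ → Tub X Y θ (s, r) = Tub X Y θ (s', r') →
        r = r' ∧ ∃ n : ℤ, s' = s + n * L)
    (hfr : Set.range (fun s => (X s, Y s)) = frontier Om)
    (hin : ∀ s r, 0 < r → r < δ → Tub X Y θ (s, r) ∈ Om)
    (hout : ∀ s r, -δ < r → r < 0 → Tub X Y θ (s, r) ∉ Om)
    (G1 G2 : ℝ × ℝ → ℂ) (h1 : ContDiff ℝ 1 G1) (h2 : ContDiff ℝ 1 G2)
    (z1 : ∀ p ∈ closure Om \ Tub X Y θ '' (Set.univ ×ˢ Set.Ioo (-δ) δ), G1 =ᶠ[nhds p] 0)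
    (z2 : ∀ p ∈ closure Om \ Tub X Y θ '' (Set.univ ×ˢ Set.Ioo (-δ) δ), G2 =ᶠ[nhds p] 0) :
    ∫ p in Om, dvg G1 G2 p = ∫ s in (0 : ℝ)..L,
      (Real.sin (θ s) • G1 (X s, Y s) - Real.cos (θ s) • G2 (X s, Y s)) := by
  have hL := H.hL
  have hTc : Continuous (Tub X Y θ) := (tub_contDiff X Y θ k L H).continuous
  set A : Set (ℝ × ℝ) := Set.Ico 0 L ×ˢ Set.Ioo 0 δ with hA
  have hAm : MeasurableSet A := measurableSet_Ico.prod measurableSet_Ioo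
  have hAsub : Tub X Y θ '' A ⊆ Om := by
    rintro _ ⟨⟨s, r⟩, ⟨-, hr⟩, rfl⟩
    exact hin s r hr.1 hr.2
  have hAinj : Set.InjOn (Tub X Y θ) A := by
    rintro ⟨s, r⟩ ⟨hs, hr⟩ ⟨s', r'⟩ ⟨hs', hr'⟩ he
    simp only at hs hr hs' hr'
    obtain ⟨e1, n, hn⟩ := hδi s s' r r' (abs_le.mpr ⟨by linarith [hr.1], hr.2.le⟩)
      (abs_le.mpr ⟨by linarith [hr'.1], hr'.2.le⟩) he
    have hn0 : n = 0 := by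
      have a1 : (n : ℝ) * L < 1 * L := by linarith [hs.1, hs'.2]
      have a2 : (-1 : ℝ) * L < n * L := by linarith [hs.2, hs'.1]
      have b1 := lt_of_mul_lt_mul_right a1 hL.le
      have b2 := lt_of_mul_lt_mul_right a2 hL.le
      have c1 : n < 1 := by exact_mod_cast b1
      have c2 : -1 < n := by exact_mod_cast b2
      omega
    subst hn0
    simp at hn
    rw [hn, e1]
  have hdiff : ∀ p ∈ Om \ Tub X Y θ '' A, dvg G1 G2 p = 0 := by
    rintro p ⟨hp, hpA⟩
    have : p ∈ closure Om \ Tub X Y θ '' (Set.univ ×ˢ Set.Ioo (-δ) δ) := by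
      refine ⟨subset_closure hp, ?_⟩
      rintro ⟨⟨s, r⟩, ⟨-, hr1, hr2⟩, he⟩
      simp only at hr1 hr2
      rcases lt_trichotomy r 0 with h | h | h
      · exact hout s r hr1 h (he ▸ hp)
      · subst h
        rw [tub_zero] at he
        have : p ∈ frontier Om := by rw [← hfr]; exact ⟨s, he⟩
        rw [hO.frontier_eq] at this
        exact this.2 hp
      · apply hpA
        obtain ⟨y, hy, hye⟩ := (tub_per X Y θ k L H r).exists_mem_Ico₀ hL s
        exact ⟨(y, r), ⟨hy, h, hr2⟩, hye.symm.trans he⟩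
    exact dvg_zero G1 G2 p (z1 p this) (z2 p this)
  rw [setIntegral_eq_of_subset_of_forall_sdiff_eq_zero hO.measurableSet hAsub hdiff,
    integral_image_eq_integral_abs_det_fderiv_smul volume hAm
      (fun x _ => (tub_hasFDerivAt X Y θ k L H x).hasFDerivWithinAt) hAinj]
  set P : ℝ × ℝ → ℂ := fun p : ℝ × ℝ => Real.cos (θ p.1) • G1 (Tub X Y θ p)
      + Real.sin (θ p.1) • G2 (Tub X Y θ p) with hP
  set Q : ℝ × ℝ → ℂ := fun p : ℝ × ℝ => (1 - p.2 * k p.1) • (Real.cos (θ p.1) • G2 (Tub X Y θ p)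
      - Real.sin (θ p.1) • G1 (Tub X Y θ p)) with hQ
  have cθ := H.cθ
  have ck := H.ck
  have cT := tub_contDiff X Y θ k L H
  have cG1 : ContDiff ℝ 1 (fun p => G1 (Tub X Y θ p)) := h1.comp cT
  have cG2 : ContDiff ℝ 1 (fun p => G2 (Tub X Y θ p)) := h2.comp cT
  have cc : ContDiff ℝ 1 (fun p : ℝ × ℝ => Real.cos (θ p.1)) := by fun_prop
  have cs : ContDiff ℝ 1 (fun p : ℝ × ℝ => Real.sin (θ p.1)) := by fun_prop
  have cJ : ContDiff ℝ 1 (fun p : ℝ × ℝ => 1 - p.2 * k p.1) := by fun_prop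
  have hPc : ContDiff ℝ 1 P := (cc.smul cG1).add (cs.smul cG2)
  have hQc : ContDiff ℝ 1 Q := cJ.smul ((cc.smul cG2).sub (cs.smul cG1))
  have e1 : ∫ x in A, |(TubD θ k x).det| • dvg G1 G2 (Tub X Y θ x) =
      ∫ x in A, (fderiv ℝ P x (1, 0) + fderiv ℝ Q x (0, 1)) := by
    refine setIntegral_congr_fun hAm fun x hx => ?_
    rw [tub_det, abs_of_pos (hδ x.1 x.2 (abs_le.mpr ⟨by linarith [hx.2.1], hx.2.2.le⟩)),
      ← piola X Y θ k L H G1 G2 h1 h2 x]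
  rw [e1]
  have e2 : A =ᵐ[volume] Set.Icc ((0, 0) : ℝ × ℝ) (L, δ) := by
    rw [← Set.Icc_prod_Icc]
    exact Measure.set_prod_ae_eq Ico_ae_eq_Icc Ioo_ae_eq_Icc
  rw [setIntegral_congr_set e2,
    integral_divergence_prod_Icc_of_hasFDerivAt_of_le P Q (fderiv ℝ P) (fderiv ℝ Q) _ _
    (by constructor <;> simp only <;> linarith)
    hPc.continuous.continuousOn hQc.continuous.continuousOn
    (fun x _ => (hPc.differentiable (by norm_num) x).hasFDerivAt)
    (fun x _ => (hQc.differentiable (by norm_num) x).hasFDerivAt)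
    ((dvg_cont P Q hPc hQc).continuousOn.integrableOn_compact isCompact_Icc)]
  have p1 : ∀ y, P (L, y) = P (0, y) := by
    intro y
    have t := tub_per X Y θ k L H y 0
    have t2 := H.pθ 0
    simp only [zero_add] at t t2
    simp only [hP, t, t2, Real.cos_add_two_pi, Real.sin_add_two_pi]
  have p2 : ∀ s, Q (s, δ) = 0 := by
    intro s
    have hm : Tub X Y θ (s, δ) ∈ closure Om \ Tub X Y θ '' (Set.univ ×ˢ Set.Ioo (-δ) δ) := by
      constructor
      · have hc : Continuous fun r => Tub X Y θ (s, r) := by fun_prop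
        have : δ ∈ closure (Set.Ioo 0 δ) := by
          rw [closure_Ioo hδ0.ne]; exact ⟨hδ0.le, le_rfl⟩
        exact map_mem_closure (f := fun r => Tub X Y θ (s, r)) hc this (fun r hr => hin s r hr.1 hr.2)
      · rintro ⟨⟨s', r'⟩, ⟨-, hr1, hr2⟩, he⟩
        simp only at hr1 hr2
        have := (hδi s' s r' δ (abs_le.mpr ⟨hr1.le, hr2.le⟩) (by rw [abs_of_pos hδ0]) he).1
        linarith
    have a1 := (z1 _ hm).self_of_nhds
    have a2 := (z2 _ hm).self_of_nhds
    simp only [hQ, a1, a2]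
    simp
  have p3 : ∀ s, Q (s, 0) = Real.cos (θ s) • G2 (X s, Y s) - Real.sin (θ s) • G1 (X s, Y s) := by
    intro s
    simp only [hQ, tub_zero]
    simp
  simp only [p1, p2, p3, intervalIntegral.integral_zero, zero_sub]
  rw [← intervalIntegral.integral_neg]
  simp

lemma dvg_thm (X Y θ k : ℝ → ℝ) (L : ℝ) (H : Crv X Y θ k L) (Om : Set (ℝ × ℝ)) (hO : IsOpen Om)
    (hb : Bornology.IsBounded Om) (hne : Om.Nonempty)
    (hfr : Set.range (fun s => (X s, Y s)) = frontier Om)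
    (F1 F2 : ℝ × ℝ → ℂ) (h1 : ContDiff ℝ 1 F1) (h2 : ContDiff ℝ 1 F2) :
    ∫ p in Om, dvg F1 F2 p = ∫ s in (0 : ℝ)..L,
      (Real.sin (θ s) • F1 (X s, Y s) - Real.cos (θ s) • F2 (X s, Y s)) := by
  obtain ⟨δ, hδ0, hδ, hδi⟩ := tub_inj X Y θ k L H
  obtain ⟨hin, hout⟩ := tub_sides X Y θ k L H Om hO hb hne hfr δ hδ0 hδ hδi
  have hV : IsOpen (Tub X Y θ '' (Set.univ ×ˢ Set.Ioo (-δ) δ)) :=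
    tub_open X Y θ k L H δ hδ _ (isOpen_univ.prod isOpen_Ioo) (by
      rintro p ⟨-, h1, h2⟩; exact abs_le.mpr ⟨h1.le, h2.le⟩)
  have hcurve : ∀ s, (X s, Y s) ∈ Tub X Y θ '' (Set.univ ×ˢ Set.Ioo (-δ) δ) := fun s =>
    ⟨(s, 0), ⟨trivial, by simp [hδ0]⟩, tub_zero _ _ _ _⟩
  set K := closure Om \ Tub X Y θ '' (Set.univ ×ˢ Set.Ioo (-δ) δ) with hK
  have hKc : IsClosed K := isClosed_closure.sdiff hV
  have hd : Disjoint Omᶜ K := by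
    rw [Set.disjoint_left]
    rintro p hp ⟨hpc, hpV⟩
    have : p ∈ frontier Om := by rw [hO.frontier_eq]; exact ⟨hpc, hp⟩
    rw [← hfr] at this
    obtain ⟨s, rfl⟩ := this
    exact hpV (hcurve s)
  obtain ⟨χ, hχ0, hχ1, -⟩ := exists_contMDiffMap_zero_one_nhds_of_isClosed
    (n := 1) (modelWithCornersSelf ℝ (ℝ × ℝ)) hO.isClosed_compl hKc hd
  have hχc : ContDiff ℝ 1 χ := contMDiff_iff_contDiff.mp χ.contMDiff
  have hχ0 : ∀ p ∉ Om, ∀ᶠ x in nhds p, χ x = 0 := fun p hp => hχ0.filter_mono (nhds_le_nhdsSet hp)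
  have hχ1 : ∀ p ∈ K, ∀ᶠ x in nhds p, χ x = 1 := fun p hp => hχ1.filter_mono (nhds_le_nhdsSet hp)
  have a1 : ContDiff ℝ 1 (fun p => χ p • F1 p) := hχc.smul h1
  have a2 : ContDiff ℝ 1 (fun p => χ p • F2 p) := hχc.smul h2
  have b1 : ContDiff ℝ 1 (fun p => (1 - χ p) • F1 p) := (contDiff_const.sub hχc).smul h1
  have b2 : ContDiff ℝ 1 (fun p => (1 - χ p) • F2 p) := (contDiff_const.sub hχc).smul h2
  have hzero := dvg_compact Om hb _ _ a1 a2
    (fun p hp => (hχ0 p hp).mono fun x hx => by simp [hx])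
    (fun p hp => (hχ0 p hp).mono fun x hx => by simp [hx])
  have htube := dvg_tube X Y θ k L H Om hO δ hδ0 hδ hδi hfr hin hout _ _ b1 b2
    (fun p hp => (hχ1 p hp).mono fun x hx => by simp [hx])
    (fun p hp => (hχ1 p hp).mono fun x hx => by simp [hx])
  have hsum : ∀ p, dvg F1 F2 p = dvg (fun p => χ p • F1 p) (fun p => χ p • F2 p) p +
      dvg (fun p => (1 - χ p) • F1 p) (fun p => (1 - χ p) • F2 p) p := by
    intro p
    have c1 : F1 = (fun p => χ p • F1 p) + (fun p => (1 - χ p) • F1 p) := by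
      funext x; simp only [Pi.add_apply, ← add_smul]; simp
    have c2 : F2 = (fun p => χ p • F2 p) + (fun p => (1 - χ p) • F2 p) := by
      funext x; simp only [Pi.add_apply, ← add_smul]; simp
    have d1 : fderiv ℝ F1 p = fderiv ℝ (fun p => χ p • F1 p) p
        + fderiv ℝ (fun p => (1 - χ p) • F1 p) p := by
      conv_lhs => rw [c1]
      exact fderiv_add (a1.differentiable (by norm_num) p) (b1.differentiable (by norm_num) p)
    have d2 : fderiv ℝ F2 p = fderiv ℝ (fun p => χ p • F2 p) p
        + fderiv ℝ (fun p => (1 - χ p) • F2 p) p := by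
      conv_lhs => rw [c2]
      exact fderiv_add (a2.differentiable (by norm_num) p) (b2.differentiable (by norm_num) p)
    simp only [dvg]
    rw [d1, d2, add_apply, add_apply]
    ring
  have hIntg : ∀ G1 G2 : ℝ × ℝ → ℂ, ContDiff ℝ 1 G1 → ContDiff ℝ 1 G2 →
      IntegrableOn (dvg G1 G2) Om := fun G1 G2 g1 g2 =>
    ((dvg_cont G1 G2 g1 g2).continuousOn.integrableOn_compact hb.isCompact_closure).mono_set
      subset_closure
  calc ∫ p in Om, dvg F1 F2 p
      = ∫ p in Om, (dvg (fun p => χ p • F1 p) (fun p => χ p • F2 p) p +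
      dvg (fun p => (1 - χ p) • F1 p) (fun p => (1 - χ p) • F2 p) p) := by
        simp only [hsum]
    _ = _ := by
        rw [integral_add (hIntg _ _ a1 a2) (hIntg _ _ b1 b2), hzero, htube, zero_add]
        have hχb : ∀ s, χ (X s, Y s) = 0 := by
          intro s
          have : (X s, Y s) ∈ frontier Om := by rw [← hfr]; exact ⟨s, rfl⟩
          rw [hO.frontier_eq] at this
          exact (hχ0 _ this.2).self_of_nhds
        simp only [hχb, sub_zero, one_smul]

lemma pdx_smooth {u : ℝ × ℝ → ℝ} (h : ContDiff ℝ (⊤ : ℕ∞) u) : ContDiff ℝ (⊤ : ℕ∞) (pdx u) :=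
  (h.fderiv_right (m := (⊤ : ℕ∞)) (by simp)).clm_apply contDiff_const

lemma pdy_smooth {u : ℝ × ℝ → ℝ} (h : ContDiff ℝ (⊤ : ℕ∞) u) : ContDiff ℝ (⊤ : ℕ∞) (pdy u) :=
  (h.fderiv_right (m := (⊤ : ℕ∞)) (by simp)).clm_apply contDiff_const

lemma smooth_diff {u : ℝ × ℝ → ℝ} (h : ContDiff ℝ (⊤ : ℕ∞) u) : Differentiable ℝ u :=
  h.differentiable (by simp)

lemma pd_comm {u : ℝ × ℝ → ℝ} (h : ContDiff ℝ (⊤ : ℕ∞) u) : pdy (pdx u) = pdx (pdy u) := by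
  funext p
  have hd : DifferentiableAt ℝ (fderiv ℝ u) p :=
    ((h.fderiv_right (m := (⊤ : ℕ∞)) (by simp)).differentiable (by simp)) p
  have hs : IsSymmSndFDerivAt ℝ u p :=
    h.contDiffAt.isSymmSndFDerivAt (by
      simp only [minSmoothness_of_isRCLikeNormedField]
      exact WithTop.coe_le_coe.mpr (le_top : (2 : ℕ∞) ≤ ⊤))
  have e := hs.eq (0, 1) (1, 0)
  have a1 : pdy (pdx u) p = fderiv ℝ (fderiv ℝ u) p (0, 1) (1, 0) := by
    unfold pdy
    have : pdx u = fun q => fderiv ℝ u q (1, 0) := rfl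
    rw [this, fderiv_clm_apply hd (by fun_prop)]
    simp
  have a2 : pdx (pdy u) p = fderiv ℝ (fderiv ℝ u) p (1, 0) (0, 1) := by
    unfold pdx
    have : pdy u = fun q => fderiv ℝ u q (0, 1) := rfl
    rw [this, fderiv_clm_apply hd (by fun_prop)]
    simp
  rw [a1, a2, e]

lemma pdx_add {u v : ℝ × ℝ → ℝ} (hu : Differentiable ℝ u) (hv : Differentiable ℝ v) :
    pdx (fun p => u p + v p) = fun p => pdx u p + pdx v p := by
  funext p
  unfold pdx
  rw [fderiv_fun_add (hu p) (hv p)]; rfl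

lemma pdy_add {u v : ℝ × ℝ → ℝ} (hu : Differentiable ℝ u) (hv : Differentiable ℝ v) :
    pdy (fun p => u p + v p) = fun p => pdy u p + pdy v p := by
  funext p
  unfold pdy
  rw [fderiv_fun_add (hu p) (hv p)]; rfl

lemma pdx_zero_on {Om : Set (ℝ × ℝ)} (hO : IsOpen Om) {f : ℝ × ℝ → ℝ} (h : ∀ p ∈ Om, f p = 0) :
    ∀ p ∈ Om, pdx f p = 0 := by
  intro p hp
  have : f =ᶠ[nhds p] fun _ => 0 := by
    filter_upwards [hO.mem_nhds hp] with q hq using h q hq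
  unfold pdx
  rw [this.fderiv_eq]; simp

lemma pdy_zero_on {Om : Set (ℝ × ℝ)} (hO : IsOpen Om) {f : ℝ × ℝ → ℝ} (h : ∀ p ∈ Om, f p = 0) :
    ∀ p ∈ Om, pdy f p = 0 := by
  intro p hp
  have : f =ᶠ[nhds p] fun _ => 0 := by
    filter_upwards [hO.mem_nhds hp] with q hq using h q hq
  unfold pdy
  rw [this.fderiv_eq]; simp

lemma zero_closure {Om : Set (ℝ × ℝ)} {f : ℝ × ℝ → ℝ} (hf : Continuous f)
    (h : ∀ p ∈ Om, f p = 0) : ∀ p ∈ closure Om, f p = 0 :=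
  fun _ hp => closure_minimal (t := {q | f q = 0}) h (isClosed_eq hf continuous_const) hp

/-- Helmholtz operator. -/
def helm (u : ℝ × ℝ → ℝ) (p : ℝ × ℝ) : ℝ := pdx (pdx u) p + pdy (pdy u) p + u p

lemma helm_smooth {u : ℝ × ℝ → ℝ} (h : ContDiff ℝ (⊤ : ℕ∞) u) : ContDiff ℝ (⊤ : ℕ∞) (helm u) :=
  ((pdx_smooth (pdx_smooth h)).add (pdy_smooth (pdy_smooth h))).add h

lemma helm_pdx {u : ℝ × ℝ → ℝ} (h : ContDiff ℝ (⊤ : ℕ∞) u) : helm (pdx u) = pdx (helm u) := by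
  have h1 := smooth_diff (pdx_smooth (pdx_smooth h))
  have h2 := smooth_diff (pdy_smooth (pdy_smooth h))
  have e : pdx (helm u) = fun p => pdx (pdx (pdx u)) p + pdx (pdy (pdy u)) p + pdx u p := by
    have e1 : helm u = fun p => (fun q => pdx (pdx u) q + pdy (pdy u) q) p + u p := rfl
    rw [e1, pdx_add (u := fun q => pdx (pdx u) q + pdy (pdy u) q) (h1.add h2) (smooth_diff h),
      pdx_add h1 h2]
  rw [e]
  funext p
  unfold helm
  rw [pd_comm h, pd_comm (pdy_smooth h)]

lemma helm_pdy {u : ℝ × ℝ → ℝ} (h : ContDiff ℝ (⊤ : ℕ∞) u) : helm (pdy u) = pdy (helm u) := by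
  have h1 := smooth_diff (pdx_smooth (pdx_smooth h))
  have h2 := smooth_diff (pdy_smooth (pdy_smooth h))
  have e : pdy (helm u) = fun p => pdy (pdx (pdx u)) p + pdy (pdy (pdy u)) p + pdy u p := by
    have e1 : helm u = fun p => (fun q => pdx (pdx u) q + pdy (pdy u) q) p + u p := rfl
    rw [e1, pdy_add (u := fun q => pdx (pdx u) q + pdy (pdy u) q) (h1.add h2) (smooth_diff h),
      pdy_add h1 h2]
  rw [e]
  funext p
  unfold helm
  rw [pd_comm (pdx_smooth h), pd_comm h]

lemma curve_deriv {X Y θ : ℝ → ℝ} (hX : ∀ s, HasDerivAt X (Real.cos (θ s)) s)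
    (hY : ∀ s, HasDerivAt Y (Real.sin (θ s)) s) {u : ℝ × ℝ → ℝ} (hu : Differentiable ℝ u) (s : ℝ) :
    HasDerivAt (fun s => u (X s, Y s))
      (Real.cos (θ s) * pdx u (X s, Y s) + Real.sin (θ s) * pdy u (X s, Y s)) s := by
  have h := (hu (X s, Y s)).hasFDerivAt.comp_hasDerivAt s ((hX s).prodMk (hY s))
  have : ((Real.cos (θ s), Real.sin (θ s)) : ℝ × ℝ)
      = Real.cos (θ s) • ((1, 0) : ℝ × ℝ) + Real.sin (θ s) • ((0, 1) : ℝ × ℝ) := by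
    ext <;> simp
  rw [this, map_add, map_smul, map_smul] at h
  exact h

/-- All boundary relations. -/
lemma bdry_rel (X Y θ k : ℝ → ℝ) (hX : ∀ s, HasDerivAt X (Real.cos (θ s)) s)
    (hY : ∀ s, HasDerivAt Y (Real.sin (θ s)) s) (hθ : ∀ s, HasDerivAt θ (k s) s)
    (Om : Set (ℝ × ℝ)) (hO : IsOpen Om) (hcl : ∀ s, (X s, Y s) ∈ closure Om)
    (u : ℝ × ℝ → ℝ) (hu : ContDiff ℝ (⊤ : ℕ∞) u) (hpde : ∀ p ∈ Om, helm u p = 0)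
    (hN : ∀ s, Real.sin (θ s) * pdx u (X s, Y s) - Real.cos (θ s) * pdy u (X s, Y s) = 0)
    (hb : ∀ s, u (X s, Y s) = 1) (s : ℝ) :
    pdx (pdx u) (X s, Y s) = - Real.sin (θ s) ^ 2 ∧
    pdx (pdy u) (X s, Y s) = Real.sin (θ s) * Real.cos (θ s) ∧
    pdy (pdy u) (X s, Y s) = - Real.cos (θ s) ^ 2 ∧
    Real.sin (θ s) * pdx (pdx (pdx u)) (X s, Y s) - Real.cos (θ s) * pdy (pdx (pdx u)) (X s, Y s)
      = - k s * Real.cos (2 * θ s) ∧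
    Real.sin (θ s) * pdx (pdx (pdy u)) (X s, Y s) - Real.cos (θ s) * pdy (pdx (pdy u)) (X s, Y s)
      = - k s * Real.sin (2 * θ s) ∧
    Real.sin (θ s) * pdx (pdy (pdy u)) (X s, Y s) - Real.cos (θ s) * pdy (pdy (pdy u)) (X s, Y s)
      = k s * Real.cos (2 * θ s) := by
  have key : ∀ {f : ℝ × ℝ → ℝ} {g : ℝ → ℝ} (_ : ContDiff ℝ (⊤ : ℕ∞) f)
      (_ : ∀ s, f (X s, Y s) = g s) (g' s : ℝ) (_ : HasDerivAt g g' s),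
      Real.cos (θ s) * pdx f (X s, Y s) + Real.sin (θ s) * pdy f (X s, Y s) = g' := by
    intro f g hf hfg g' s hg
    have e : (fun s => f (X s, Y s)) = g := funext hfg
    have := curve_deriv hX hY (smooth_diff hf) s
    rw [e] at this
    exact this.unique hg
  have sc : ∀ s, Real.sin (θ s) ^ 2 + Real.cos (θ s) ^ 2 = 1 := fun s => Real.sin_sq_add_cos_sq _
  have t0 : ∀ s, _ := fun s => key hu hb 0 s (hasDerivAt_const s 1)
  have ux : ∀ s, pdx u (X s, Y s) = 0 := by
    intro s
    linear_combination Real.cos (θ s) * t0 s + Real.sin (θ s) * hN s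
      - pdx u (X s, Y s) * sc s
  have uy : ∀ s, pdy u (X s, Y s) = 0 := by
    intro s
    linear_combination Real.sin (θ s) * t0 s - Real.cos (θ s) * hN s
      - pdy u (X s, Y s) * sc s
  have t1 : ∀ s, _ := fun s => key (pdx_smooth hu) ux 0 s (hasDerivAt_const s 0)
  have t2 : ∀ s, _ := fun s => key (pdy_smooth hu) uy 0 s (hasDerivAt_const s 0)
  rw [pd_comm hu] at t1
  have hE : ∀ s, helm u (X s, Y s) = 0 := fun s =>
    zero_closure (helm_smooth hu).continuous hpde _ (hcl s)
  have hEx : ∀ s, helm (pdx u) (X s, Y s) = 0 := fun s => by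
    rw [helm_pdx hu]
    exact zero_closure (pdx_smooth (helm_smooth hu)).continuous (pdx_zero_on hO hpde) _ (hcl s)
  have hEy : ∀ s, helm (pdy u) (X s, Y s) = 0 := fun s => by
    rw [helm_pdy hu]
    exact zero_closure (pdy_smooth (helm_smooth hu)).continuous (pdy_zero_on hO hpde) _ (hcl s)
  unfold helm at hE hEx hEy
  have ha : ∀ s, pdx (pdx u) (X s, Y s) = - Real.sin (θ s) ^ 2 := by
    intro s
    linear_combination Real.cos (θ s) * t1 s - Real.sin (θ s) * t2 s
      + Real.sin (θ s) ^ 2 * (hE s) - Real.sin (θ s) ^ 2 * hb s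
      - pdx (pdx u) (X s, Y s) * sc s
  have hc : ∀ s, pdy (pdy u) (X s, Y s) = - Real.cos (θ s) ^ 2 := by
    intro s
    linear_combination hE s - hb s - ha s + sc s
  have hbb : ∀ s, pdx (pdy u) (X s, Y s) = Real.sin (θ s) * Real.cos (θ s) := by
    intro s
    linear_combination Real.sin (θ s) * t1 s + Real.cos (θ s) * t2 s
      - Real.sin (θ s) * Real.cos (θ s) * (hE s - hb s) - pdx (pdy u) (X s, Y s) * sc s
  have t3 := key (pdx_smooth (pdx_smooth hu)) ha _ s (((hθ s).sin.pow 2).neg)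
  have t4 := key (pdx_smooth (pdy_smooth hu)) hbb _ s ((hθ s).sin.mul (hθ s).cos)
  have e3 : pdy (pdx (pdx u)) = pdx (pdx (pdy u)) := by
    rw [pd_comm (pdx_smooth hu), pd_comm hu]
  have e4 : pdy (pdx (pdy u)) = pdx (pdy (pdy u)) := pd_comm (pdy_smooth hu)
  have f1 := hEx s
  have f2 := hEy s
  rw [pd_comm hu, e4, ux s] at f1
  rw [uy s] at f2
  rw [e3] at t3 ⊢
  rw [e4] at t4 ⊢
  have scs := sc s
  refine ⟨ha s, hbb s, hc s, ?_⟩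
  rw [Real.cos_two_mul', Real.sin_two_mul]
  generalize Real.sin (θ s) = S at *
  generalize Real.cos (θ s) = C at *
  generalize pdx (pdx (pdx u)) (X s, Y s) = p at *
  generalize pdx (pdx (pdy u)) (X s, Y s) = q at *
  generalize pdx (pdy (pdy u)) (X s, Y s) = r at *
  generalize pdy (pdy (pdy u)) (X s, Y s) = t at *
  have hr : r = -p := by linarith
  have ht : t = -q := by linarith
  subst hr ht
  have hp : p = - (3 * S * C ^ 2 - S ^ 3) * k s := by
    norm_num at t3 t4
    linear_combination C * t3 - S * t4 - p * scs
  have hq : q = (C ^ 3 - 3 * S ^ 2 * C) * k s := by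
    norm_num at t3 t4
    linear_combination S * t3 + C * t4 - q * scs
  refine ⟨?_, ?_, ?_⟩
  · rw [hp, hq]; linear_combination (-k s * (C ^ 2 - S ^ 2)) * scs
  · rw [hp, hq]; linear_combination (-k s * (2 * S * C)) * scs
  · rw [hp, hq]; linear_combination (k s * (C ^ 2 - S ^ 2)) * scs

/-- Complex combination of three real functions. -/
def comb (c₁ c₂ c₃ : ℂ) (f g h : ℝ × ℝ → ℝ) (p : ℝ × ℝ) : ℂ :=
  c₁ * (f p : ℂ) + c₂ * (g p : ℂ) + c₃ * (h p : ℂ)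

lemma comb_hasFDerivAt (c₁ c₂ c₃ : ℂ) {f g h : ℝ × ℝ → ℝ} (hf : Differentiable ℝ f)
    (hg : Differentiable ℝ g) (hh : Differentiable ℝ h) (p v : ℝ × ℝ) :
    fderiv ℝ (comb c₁ c₂ c₃ f g h) p v =
      c₁ * (fderiv ℝ f p v : ℂ) + c₂ * (fderiv ℝ g p v : ℂ) + c₃ * (fderiv ℝ h p v : ℂ) := by
  have of : ∀ {f : ℝ × ℝ → ℝ}, Differentiable ℝ f → ∀ c : ℂ,
      HasFDerivAt (fun q => c * (f q : ℂ)) (c • (Complex.ofRealCLM.comp (fderiv ℝ f p))) p := by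
    intro f hf c
    have := Complex.ofRealCLM.hasFDerivAt.comp p (hf p).hasFDerivAt
    exact this.const_mul c
  have := (((of hf c₁).add (of hg c₂)).add (of hh c₃)).fderiv
  have e : comb c₁ c₂ c₃ f g h = (((fun q => c₁ * (f q : ℂ)) + fun q => c₂ * (g q : ℂ)) + 
    fun q => c₃ * (h q : ℂ)) := rfl
  rw [e, this]
  simp

lemma comb_smooth (c₁ c₂ c₃ : ℂ) {f g h : ℝ × ℝ → ℝ} (hf : ContDiff ℝ (⊤ : ℕ∞) f)
    (hg : ContDiff ℝ (⊤ : ℕ∞) g) (hh : ContDiff ℝ (⊤ : ℕ∞) h) :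
    ContDiff ℝ (⊤ : ℕ∞) (comb c₁ c₂ c₃ f g h) := by
  have of : ∀ {f : ℝ × ℝ → ℝ}, ContDiff ℝ (⊤ : ℕ∞) f → 
      ContDiff ℝ (⊤ : ℕ∞) (fun q => (f q : ℂ)) := fun hf => Complex.ofRealCLM.contDiff.comp hf
  exact ((contDiff_const.mul (of hf)).add (contDiff_const.mul (of hg))).add
    (contDiff_const.mul (of hh))

lemma comb_pdx (c₁ c₂ c₃ : ℂ) {f g h : ℝ × ℝ → ℝ} (hf : ContDiff ℝ (⊤ : ℕ∞) f)
    (hg : ContDiff ℝ (⊤ : ℕ∞) g) (hh : ContDiff ℝ (⊤ : ℕ∞) h) :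
    pdxC (comb c₁ c₂ c₃ f g h) = comb c₁ c₂ c₃ (pdx f) (pdx g) (pdx h) :=
  funext fun p => comb_hasFDerivAt c₁ c₂ c₃ (smooth_diff hf) (smooth_diff hg) (smooth_diff hh) p _

lemma comb_pdy (c₁ c₂ c₃ : ℂ) {f g h : ℝ × ℝ → ℝ} (hf : ContDiff ℝ (⊤ : ℕ∞) f)
    (hg : ContDiff ℝ (⊤ : ℕ∞) g) (hh : ContDiff ℝ (⊤ : ℕ∞) h) :
    pdyC (comb c₁ c₂ c₃ f g h) = comb c₁ c₂ c₃ (pdy f) (pdy g) (pdy h) :=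
  funext fun p => comb_hasFDerivAt c₁ c₂ c₃ (smooth_diff hf) (smooth_diff hg) (smooth_diff hh) p _

lemma comb_conj (c₁ c₂ c₃ : ℂ) (f g h : ℝ × ℝ → ℝ) (p : ℝ × ℝ) :
    conj (comb c₁ c₂ c₃ f g h p) = comb (conj c₁) (conj c₂) (conj c₃) f g h p := by
  simp [comb]

/-- Integration by parts for the quadratic form. -/
lemma bform_parts (X Y θ k : ℝ → ℝ) (L : ℝ) (H : Crv X Y θ k L) (Om : Set (ℝ × ℝ)) (hO : IsOpen Om)
    (hbd : Bornology.IsBounded Om) (hne : Om.Nonempty)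
    (hfr : Set.range (fun s => (X s, Y s)) = frontier Om)
    (c₁ c₂ c₃ : ℂ) {f g h : ℝ × ℝ → ℝ} (hf : ContDiff ℝ (⊤ : ℕ∞) f)
    (hg : ContDiff ℝ (⊤ : ℕ∞) g) (hh : ContDiff ℝ (⊤ : ℕ∞) h)
    (ef : ∀ p ∈ Om, helm f p = 0) (eg : ∀ p ∈ Om, helm g p = 0) (eh : ∀ p ∈ Om, helm h p = 0) :
    Bform Om 1 (comb c₁ c₂ c₃ f g h) (comb c₁ c₂ c₃ f g h) =
      ∫ s in (0 : ℝ)..L, conj (comb c₁ c₂ c₃ f g h (X s, Y s)) *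
        (Real.sin (θ s) * comb c₁ c₂ c₃ (pdx f) (pdx g) (pdx h) (X s, Y s)
          - Real.cos (θ s) * comb c₁ c₂ c₃ (pdy f) (pdy g) (pdy h) (X s, Y s)) := by
  set ψc := comb (conj c₁) (conj c₂) (conj c₃) f g h with hψc
  have s0 : ContDiff ℝ (⊤ : ℕ∞) ψc := comb_smooth _ _ _ hf hg hh
  have sx := comb_smooth c₁ c₂ c₃ (pdx_smooth hf) (pdx_smooth hg) (pdx_smooth hh)
  have sy := comb_smooth c₁ c₂ c₃ (pdy_smooth hf) (pdy_smooth hg) (pdy_smooth hh)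
  set ψx := comb c₁ c₂ c₃ (pdx f) (pdx g) (pdx h) with hψx
  set ψy := comb c₁ c₂ c₃ (pdy f) (pdy g) (pdy h) with hψy
  have D := dvg_thm X Y θ k L H Om hO hbd hne hfr (fun p => ψc p * ψx p) (fun p => ψc p * ψy p)
    ((s0.mul sx).of_le (by exact_mod_cast le_top)) ((s0.mul sy).of_le (by exact_mod_cast le_top))
  have e : ∫ p in Om, dvg (fun p => ψc p * ψx p) (fun p => ψc p * ψy p) p =
      Bform Om 1 (comb c₁ c₂ c₃ f g h) (comb c₁ c₂ c₃ f g h) := by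
    unfold Bform
    refine setIntegral_congr_fun hO.measurableSet fun p hp => ?_
    have d0 : DifferentiableAt ℝ ψc p := s0.differentiable (by simp) p
    have dx : DifferentiableAt ℝ ψx p := sx.differentiable (by simp) p
    have dy : DifferentiableAt ℝ ψy p := sy.differentiable (by simp) p
    have m1 : fderiv ℝ (fun p => ψc p * ψx p) p (1, 0) = ψc p * pdxC ψx p + pdxC ψc p * ψx p := by
      rw [fderiv_fun_mul d0 dx]
      simp [pdxC, mul_comm]
    have m2 : fderiv ℝ (fun p => ψc p * ψy p) p (0, 1) = ψc p * pdyC ψy p + pdyC ψc p * ψy p := by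
      rw [fderiv_fun_mul d0 dy]
      simp [pdyC, mul_comm]
    have e1 : pdxC ψx p + pdyC ψy p + comb c₁ c₂ c₃ f g h p = 0 := by
      rw [hψx, hψy, comb_pdx _ _ _ (pdx_smooth hf) (pdx_smooth hg) (pdx_smooth hh),
        comb_pdy _ _ _ (pdy_smooth hf) (pdy_smooth hg) (pdy_smooth hh)]
      have a1 : ((helm f p : ℝ) : ℂ) = 0 := by rw [ef p hp]; simp
      have a2 : ((helm g p : ℝ) : ℂ) = 0 := by rw [eg p hp]; simp
      have a3 : ((helm h p : ℝ) : ℂ) = 0 := by rw [eh p hp]; simp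
      unfold helm at a1 a2 a3
      push_cast at a1 a2 a3
      unfold comb
      linear_combination c₁ * a1 + c₂ * a2 + c₃ * a3
    unfold dvg
    rw [m1, m2, comb_pdx c₁ c₂ c₃ hf hg hh, comb_pdy c₁ c₂ c₃ hf hg hh, comb_conj, comb_conj, comb_conj,
      hψc, comb_pdx _ _ _ hf hg hh, comb_pdy _ _ _ hf hg hh, ← hψc]
    push_cast
    linear_combination ψc p * e1
  rw [← e, D]
  refine intervalIntegral.integral_congr fun s _ => ?_
  simp only [comb_conj, Complex.real_smul]
  rw [← hψc]
  ring

lemma P_int (c₁ c₂ c₃ : ℂ) : ∫ t in (0 : ℝ)..(2 * π), (c₁ * (Real.cos (2 * t) : ℂ)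
    + c₂ * (Real.sin (2 * t) : ℂ) - c₃ * (Real.cos (2 * t) : ℂ)) = 0 := by
  have h1 : ∫ t in (0 : ℝ)..(2 * π), (Real.cos (2 * t) : ℂ) = 0 := by
    rw [intervalIntegral.integral_ofReal]
    rw [intervalIntegral.integral_comp_mul_left (fun x => Real.cos x) (by norm_num)]
    have : Real.sin (2 * (2 * π)) = 0 := by
      have := Real.sin_nat_mul_pi 4
      rw [← this]; congr 1; push_cast; ring
    simp [this]
  have h2 : ∫ t in (0 : ℝ)..(2 * π), (Real.sin (2 * t) : ℂ) = 0 := by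
    rw [intervalIntegral.integral_ofReal]
    rw [intervalIntegral.integral_comp_mul_left (fun x => Real.sin x) (by norm_num)]
    have : Real.cos (2 * (2 * π)) = 1 := by
      have := Real.cos_nat_mul_two_pi 2
      rw [← this]; congr 1
    simp [this]
  have e : ∀ t : ℝ, c₁ * (Real.cos (2 * t) : ℂ) + c₂ * (Real.sin (2 * t) : ℂ)
      - c₃ * (Real.cos (2 * t) : ℂ) = (c₁ - c₃) * (Real.cos (2 * t) : ℂ)
      + c₂ * (Real.sin (2 * t) : ℂ) := fun t => by ring
  simp only [e]
  rw [intervalIntegral.integral_add, intervalIntegral.integral_const_mul,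
    intervalIntegral.integral_const_mul, h1, h2]
  · simp
  · exact Continuous.intervalIntegrable (by fun_prop) _ _
  · exact Continuous.intervalIntegrable (by fun_prop) _ _

/-- The core identity for globally smooth `u`. -/
lemma core (X Y θ k : ℝ → ℝ) (L : ℝ) (H : Crv X Y θ k L) (Om : Set (ℝ × ℝ)) (hO : IsOpen Om)
    (hbd : Bornology.IsBounded Om) (hne : Om.Nonempty)
    (hfr : Set.range (fun s => (X s, Y s)) = frontier Om)
    (u : ℝ × ℝ → ℝ) (hu : ContDiff ℝ (⊤ : ℕ∞) u) (hpde : ∀ p ∈ Om, helm u p = 0)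
    (hN : ∀ s, Real.sin (θ s) * pdx u (X s, Y s) - Real.cos (θ s) * pdy u (X s, Y s) = 0)
    (hb : ∀ s, u (X s, Y s) = 1) (c₁ c₂ c₃ : ℂ) :
    Bform Om 1 (comb c₁ c₂ c₃ (pdx (pdx u)) (pdx (pdy u)) (pdy (pdy u)))
      (comb c₁ c₂ c₃ (pdx (pdx u)) (pdx (pdy u)) (pdy (pdy u))) =
      ((-(1 / 2) * ∫ t in (0 : ℝ)..(2 * π),
          Complex.normSq (c₁ * (Real.cos (2 * t) : ℂ) + c₂ * (Real.sin (2 * t) : ℂ)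
            - c₃ * (Real.cos (2 * t) : ℂ)) : ℝ) : ℂ) := by
  have hcl : ∀ s, (X s, Y s) ∈ closure Om := fun s =>
    frontier_subset_closure (hfr ▸ Set.mem_range_self s)
  have R := bdry_rel X Y θ k H.hX H.hY H.hθ Om hO hcl u hu hpde hN hb
  have hx : ∀ p ∈ Om, helm (pdx u) p = 0 := by
    rw [helm_pdx hu]; exact pdx_zero_on hO hpde
  have hy : ∀ p ∈ Om, helm (pdy u) p = 0 := by
    rw [helm_pdy hu]; exact pdy_zero_on hO hpde
  rw [bform_parts X Y θ k L H Om hO hbd hne hfr c₁ c₂ c₃ (pdx_smooth (pdx_smooth hu))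
    (pdx_smooth (pdy_smooth hu)) (pdy_smooth (pdy_smooth hu))
    (by rw [helm_pdx (pdx_smooth hu)]; exact pdx_zero_on hO hx)
    (by rw [helm_pdx (pdy_smooth hu)]; exact pdx_zero_on hO hy)
    (by rw [helm_pdy (pdy_smooth hu)]; exact pdy_zero_on hO hy)]
  set P : ℝ → ℂ := fun t => c₁ * (Real.cos (2 * t) : ℂ) + c₂ * (Real.sin (2 * t) : ℂ)
            - c₃ * (Real.cos (2 * t) : ℂ) with hP
  have cP : Continuous P := by fun_prop
  set G : ℝ → ℂ := fun t => -(1 / 2) * (Complex.normSq (P t) : ℂ)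
    + (1 / 2) * conj (c₁ + c₃) * P t with hG
  have cG : Continuous G := by
    have : Continuous fun t => Complex.normSq (P t) := Complex.continuous_normSq.comp cP
    have := Complex.continuous_ofReal.comp this
    exact (continuous_const.mul this).add (continuous_const.mul cP)
  have pP : Function.Periodic P (2 * π) := by
    intro t
    have a : 2 * (t + 2 * π) = 2 * t + (2 : ℕ) * (2 * π) := by push_cast; ring
    simp only [hP, a, Real.cos_add_nat_mul_two_pi, Real.sin_add_nat_mul_two_pi]
  have pG : Function.Periodic G (2 * π) := by
    intro t
    simp only [hG, pP t]
  have e1 : ∀ s, conj (comb c₁ c₂ c₃ (pdx (pdx u)) (pdx (pdy u)) (pdy (pdy u)) (X s, Y s)) *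
        (Real.sin (θ s) * comb c₁ c₂ c₃ (pdx (pdx (pdx u))) (pdx (pdx (pdy u)))
          (pdx (pdy (pdy u))) (X s, Y s)
          - Real.cos (θ s) * comb c₁ c₂ c₃ (pdy (pdx (pdx u))) (pdy (pdx (pdy u)))
          (pdy (pdy (pdy u))) (X s, Y s)) = k s • G (θ s) := by
    intro s
    obtain ⟨r1, r2, r3, r4, r5, r6⟩ := R s
    have i1 : Real.sin (θ s) * comb c₁ c₂ c₃ (pdx (pdx (pdx u))) (pdx (pdx (pdy u)))
          (pdx (pdy (pdy u))) (X s, Y s)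
          - Real.cos (θ s) * comb c₁ c₂ c₃ (pdy (pdx (pdx u))) (pdy (pdx (pdy u)))
          (pdy (pdy (pdy u))) (X s, Y s) = - (k s : ℂ) * P (θ s) := by
      have r4' := congrArg (fun x : ℝ => (x : ℂ)) r4
      have r5' := congrArg (fun x : ℝ => (x : ℂ)) r5
      have r6' := congrArg (fun x : ℝ => (x : ℂ)) r6
      simp only [Complex.ofReal_sub, Complex.ofReal_mul, Complex.ofReal_neg] at r4' r5' r6'
      simp only [comb, hP]
      linear_combination c₁ * r4' + c₂ * r5' + c₃ * r6'
    have i2 : comb c₁ c₂ c₃ (pdx (pdx u)) (pdx (pdy u)) (pdy (pdy u)) (X s, Y s)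
        = 1 / 2 * P (θ s) - 1 / 2 * (c₁ + c₃) := by
      have q1 : (Real.cos (2 * θ s) : ℂ) = 1 - 2 * (Real.sin (θ s) : ℂ) ^ 2 := by
        rw [Real.cos_two_mul, Real.cos_sq']; push_cast; ring
      have q2 : (Real.sin (2 * θ s) : ℂ) = 2 * Real.sin (θ s) * Real.cos (θ s) := by
        rw [Real.sin_two_mul]; push_cast; ring
      have q3 : (Real.cos (θ s) : ℂ) ^ 2 = 1 - (Real.sin (θ s) : ℂ) ^ 2 := by
        rw [← Complex.ofReal_pow, Real.cos_sq']; push_cast; ring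
      simp only [comb, hP, r1, r2, r3, q1, q2, Complex.ofReal_neg, Complex.ofReal_mul,
        Complex.ofReal_pow, q3]
      ring
    rw [i1, i2, Complex.real_smul]
    simp only [hG, Complex.normSq_eq_conj_mul_self]
    simp only [map_sub, map_mul, map_add, map_div₀, map_one, map_ofNat]
    ring
  simp only [e1]
  have e2 : ∫ s in (0 : ℝ)..L, k s • G (θ s) = ∫ t in (θ 0)..(θ L), G t := by
    have := intervalIntegral.integral_deriv_smul_comp (a := 0) (b := L) (f := θ) (f' := k) (g := G)
      (fun s _ => H.hθ s) H.ck.continuous.continuousOn cG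
    exact this
  have e3 : θ L = θ 0 + 2 * π := by
    have := H.pθ 0
    rwa [zero_add] at this
  rw [e2, e3, pG.intervalIntegral_add_eq (θ 0) 0, zero_add]
  simp only [hG]
  rw [intervalIntegral.integral_add, intervalIntegral.integral_const_mul,
    intervalIntegral.integral_const_mul, intervalIntegral.integral_ofReal]
  · have := P_int c₁ c₂ c₃
    rw [show (fun t : ℝ => c₁ * (Real.cos (2 * t) : ℂ)
    + c₂ * (Real.sin (2 * t) : ℂ) - c₃ * (Real.cos (2 * t) : ℂ)) = P from rfl] at this
    rw [this, mul_zero, add_zero]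
    change _ = ((-(1 / 2) * ∫ t in (0 : ℝ)..(2 * π), Complex.normSq (P t) : ℝ) : ℂ)
    rw [Complex.ofReal_mul]
    congr 1
    norm_num
  · exact (continuous_const.mul (Complex.continuous_ofReal.comp
      (Complex.continuous_normSq.comp cP))).intervalIntegrable _ _
  · exact (continuous_const.mul cP).intervalIntegrable _ _

lemma ev_pdx {u v : ℝ × ℝ → ℝ} {p : ℝ × ℝ} (h : u =ᶠ[nhds p] v) : pdx u =ᶠ[nhds p] pdx v := by
  filter_upwards [h.fderiv (𝕜 := ℝ)] with q hq
  unfold pdx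
  rw [hq]

lemma ev_pdy {u v : ℝ × ℝ → ℝ} {p : ℝ × ℝ} (h : u =ᶠ[nhds p] v) : pdy u =ᶠ[nhds p] pdy v := by
  filter_upwards [h.fderiv (𝕜 := ℝ)] with q hq
  unfold pdy
  rw [hq]

lemma smooth_ext (Om : Set (ℝ × ℝ)) (u : ℝ × ℝ → ℝ) (h : SmoothNearClosure Om u) :
    ∃ v : ℝ × ℝ → ℝ, ContDiff ℝ (⊤ : ℕ∞) v ∧ ∀ p ∈ closure Om, v =ᶠ[nhds p] u := by
  obtain ⟨U, hU, hcl, hu⟩ := h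
  obtain ⟨f, f0, f1, -⟩ := exists_contMDiffMap_zero_one_nhds_of_isClosed
    (modelWithCornersSelf ℝ (ℝ × ℝ)) (n := (⊤ : ℕ∞)) hU.isClosed_compl (isClosed_closure (s := Om))
    (Set.disjoint_left.mpr fun x hx hx' => hx (hcl hx'))
  have hf : ContDiff ℝ (⊤ : ℕ∞) f := contMDiff_iff_contDiff.mp f.contMDiff
  refine ⟨fun p => f p * u p, ?_, ?_⟩
  · rw [contDiff_iff_contDiffAt]
    intro p
    by_cases hp : p ∈ U
    · exact hf.contDiffAt.mul (hu.contDiffAt (hU.mem_nhds hp))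
    · have : (fun p => f p * u p) =ᶠ[nhds p] fun _ => 0 := by
        filter_upwards [f0.filter_mono (nhds_le_nhdsSet hp)] with q hq
        simp [hq]
      exact contDiffAt_const.congr_of_eventuallyEq this
  · intro p hp
    filter_upwards [f1.filter_mono (nhds_le_nhdsSet hp)] with q hq
    simp [hq]

lemma crv_of (γ : ℝ → ℝ × ℝ) (θ : ℝ → ℝ) (L : ℝ) (hL : 0 < L)
    (hγsmooth : ContDiff ℝ (⊤ : ℕ∞) γ) (hθsmooth : ContDiff ℝ (⊤ : ℕ∞) θ)
    (hγper : ∀ s, γ (s + L) = γ s)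
    (hθper : ∀ s, θ (s + L) = θ s + 2 * π)
    (hinj : Set.InjOn γ (Set.Ico 0 L))
    (hγderiv : ∀ s, deriv γ s = (Real.cos (θ s), Real.sin (θ s))) :
    Crv (fun s => (γ s).1) (fun s => (γ s).2) θ (deriv θ) L := by
  have hd : ∀ s, HasDerivAt γ (Real.cos (θ s), Real.sin (θ s)) s := fun s => by
    rw [← hγderiv]
    exact (hγsmooth.differentiable (by simp) s).hasDerivAt
  have l1 : (1 : WithTop ℕ∞) ≤ ((⊤ : ℕ∞) : WithTop ℕ∞) := by exact_mod_cast le_top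
  have h1 := hγsmooth.of_le l1
  have hp : Function.Periodic γ L := hγper
  refine ⟨hL, fun s => ?_, fun s => ?_, fun s => ?_, contDiff_fst.comp h1, contDiff_snd.comp h1,
    hθsmooth.of_le l1, ?_, fun s => ?_, fun s => ?_, hθper, ?_⟩
  · have := (ContinuousLinearMap.fst ℝ ℝ ℝ).hasFDerivAt.comp_hasDerivAt s (hd s)
    exact this
  · have := (ContinuousLinearMap.snd ℝ ℝ ℝ).hasFDerivAt.comp_hasDerivAt s (hd s)
    exact this
  · exact (hθsmooth.differentiable (by simp) s).hasDerivAt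
  · have : ContDiff ℝ ((1 : ℕ∞) + 1 : WithTop ℕ∞) θ := hθsmooth.of_le (by exact_mod_cast le_top)
    exact (contDiff_succ_iff_deriv.mp this).2.2
  · simp only [hγper]
  · simp only [hγper]
  · rintro s h h0 hl ⟨e1, e2⟩
    have e : γ (s + h) = γ s := Prod.ext e1 e2
    have m1 := toIcoMod_mem_Ico' hL (s + h)
    have m2 := toIcoMod_mem_Ico' hL s
    have g1 : γ (toIcoMod hL 0 (s + h)) = γ (s + h) := by
      rw [← self_sub_toIcoDiv_zsmul]; exact hp.sub_zsmul_eq _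
    have g2 : γ (toIcoMod hL 0 s) = γ s := by
      rw [← self_sub_toIcoDiv_zsmul]; exact hp.sub_zsmul_eq _
    have e3 := hinj m1 m2 (by rw [g1, g2, e])
    rw [← self_sub_toIcoDiv_zsmul, ← self_sub_toIcoDiv_zsmul] at e3
    generalize toIcoDiv hL 0 (s + h) = a at e3
    generalize toIcoDiv hL 0 s = b at e3
    simp only [zsmul_eq_mul] at e3
    have e4 : h = ((a - b : ℤ) : ℝ) * L := by push_cast; linarith
    have u1 : (0 : ℝ) < ((a - b : ℤ) : ℝ) := by
      by_contra hc
      push Not at hc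
      nlinarith
    have u2 : ((a - b : ℤ) : ℝ) < 1 := by
      by_contra hc
      push Not at hc
      nlinarith
    have v1 : 0 < a - b := by exact_mod_cast u1
    have v2 : a - b < 1 := by exact_mod_cast u2
    omega

/-- For `ψ = c₁ω_xx + c₂ω_xy + c₃ω_yy` with complex `cᵢ`,
`B(ψ,ψ;1) = -½ ∫₀^{2π} |c₁ cos 2θ + c₂ sin 2θ - c₃ cos 2θ|² dθ ≤ 0`. -/
theorem quadratic_form_on_second_derivatives
    (Om : Set (ℝ × ℝ)) (hopen : IsOpen Om) (hconn : IsConnected Om)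
    (hbdd : Bornology.IsBounded Om)
    (L : ℝ) (hL : 0 < L)
    (γ : ℝ → ℝ × ℝ) (θ : ℝ → ℝ)
    (hγsmooth : ContDiff ℝ (⊤ : ℕ∞) γ) (hθsmooth : ContDiff ℝ (⊤ : ℕ∞) θ)
    (hγper : ∀ s, γ (s + L) = γ s)
    (hθper : ∀ s, θ (s + L) = θ s + 2 * π)
    (hrange : Set.range γ = frontier Om)
    (hinj : Set.InjOn γ (Set.Ico 0 L))
    (hγderiv : ∀ s, deriv γ s = (Real.cos (θ s), Real.sin (θ s)))
    (ω : ℝ × ℝ → ℝ)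
    (hωsmooth : SmoothNearClosure Om ω)
    (hωpde : ∀ p ∈ Om, - lap ω p = ω p)
    (hωNeumann : ∀ s, nderiv (θ s) ω (γ s) = 0)
    (hωbdry : ∀ p ∈ frontier Om, ω p = 1)
    (c₁ c₂ c₃ : ℂ) :
    Bform Om 1
        (fun p => c₁ * ((pdx (pdx ω) p : ℝ) : ℂ) + c₂ * ((pdx (pdy ω) p : ℝ) : ℂ)
          + c₃ * ((pdy (pdy ω) p : ℝ) : ℂ))
        (fun p => c₁ * ((pdx (pdx ω) p : ℝ) : ℂ) + c₂ * ((pdx (pdy ω) p : ℝ) : ℂ)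
          + c₃ * ((pdy (pdy ω) p : ℝ) : ℂ))
      = ((-(1 / 2) * ∫ t in (0 : ℝ)..(2 * π),
          Complex.normSq (c₁ * (Real.cos (2 * t) : ℂ) + c₂ * (Real.sin (2 * t) : ℂ)
            - c₃ * (Real.cos (2 * t) : ℂ)) : ℝ) : ℂ)
    ∧ (-(1 / 2) * ∫ t in (0 : ℝ)..(2 * π),
          Complex.normSq (c₁ * (Real.cos (2 * t) : ℂ) + c₂ * (Real.sin (2 * t) : ℂ)
            - c₃ * (Real.cos (2 * t) : ℂ))) ≤ 0 := by
  obtain ⟨v, hv, hvω⟩ := smooth_ext Om ω hωsmooth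
  have H := crv_of γ θ L hL hγsmooth hθsmooth hγper hθper hinj hγderiv
  have hfr : Set.range (fun s => ((γ s).1, (γ s).2)) = frontier Om := hrange
  have hγcl : ∀ s, γ s ∈ closure Om := fun s =>
    frontier_subset_closure (hrange ▸ Set.mem_range_self s)
  have hωb : ∀ s, ω (γ s) = 1 := fun s => hωbdry _ (hrange ▸ Set.mem_range_self s)
  have cr := core (fun s => (γ s).1) (fun s => (γ s).2) θ (deriv θ) L H Om hopen hbdd
    hconn.nonempty hfr v hv
    (by
      intro p hp
      have h1 := hvω p (subset_closure hp)
      have h2 := hωpde p hp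
      unfold helm
      unfold lap at h2
      rw [(ev_pdx (ev_pdx h1)).self_of_nhds, (ev_pdy (ev_pdy h1)).self_of_nhds, h1.self_of_nhds]
      linarith)
    (by
      intro s
      have h1 := hvω (γ s) (hγcl s)
      have h2 := hωNeumann s
      unfold nderiv at h2
      change Real.sin (θ s) * pdx v (γ s) - Real.cos (θ s) * pdy v (γ s) = 0
      rw [(ev_pdx h1).self_of_nhds, (ev_pdy h1).self_of_nhds, h2])
    (fun s => by
      change v (γ s) = 1
      rw [(hvω (γ s) (hγcl s)).self_of_nhds, hωb s]) c₁ c₂ c₃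
  constructor
  · rw [← cr]
    unfold Bform
    refine setIntegral_congr_fun hopen.measurableSet fun p hp => ?_
    have h1 := hvω p (subset_closure hp)
    have h2 : comb c₁ c₂ c₃ (pdx (pdx v)) (pdx (pdy v)) (pdy (pdy v)) =ᶠ[nhds p]
        (fun p => c₁ * ((pdx (pdx ω) p : ℝ) : ℂ) + c₂ * ((pdx (pdy ω) p : ℝ) : ℂ)
          + c₃ * ((pdy (pdy ω) p : ℝ) : ℂ)) := by
      filter_upwards [ev_pdx (ev_pdx h1), ev_pdx (ev_pdy h1), ev_pdy (ev_pdy h1)] with q a1 a2 a3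
      simp only [comb, a1, a2, a3]
    simp only [pdxC, pdyC, h2.fderiv_eq, h2.self_of_nhds]
  · have : 0 ≤ ∫ t in (0 : ℝ)..(2 * π),
          Complex.normSq (c₁ * (Real.cos (2 * t) : ℂ) + c₂ * (Real.sin (2 * t) : ℂ)
            - c₃ * (Real.cos (2 * t) : ℂ)) :=
      intervalIntegral.integral_nonneg (by positivity) fun t _ => Complex.normSq_nonneg _
    linarith
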